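/- Let d ∈ N, s > 1/2 and 0 < r < ∞. Then lim_{n→∞} [ n^{s − 1/2} · a_n(I_d : H^{s,r}_mix(T^d) → L∞(T^d)) / (ln n)^{(d−1)s} ] = (1/√(2s−1)) · (2^d/(d−1)!)^{s}, where I_d denotes the embedding of H^{s,r}_mix(T^d) into L∞(T^d). -/

import Mathlib

open MeasureTheory Filter
open scoped ENNReal NNReal

noncomputable section

/-- The index lattice `ℤ^d`. -/
abbrev ZLat (d : ℕ) := Fin d → ℤ

instance fact_two_pi_pos : Fact (0 < 2 * Real.pi) := ⟨by positivity⟩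

/-- The `d`-dimensional torus `𝕋^d = [0,2π]^d` with endpoints identified. -/
abbrev Torus (d : ℕ) := Fin d → AddCircle (2 * Real.pi)

/-- The normalized Lebesgue measure `(2π)^{-d} dx` on the `d`-torus. -/
def torusMeasure (d : ℕ) : Measure (Torus d) :=
  ((ENNReal.ofReal (2 * Real.pi))⁻¹) ^ d • Measure.pi fun _ => volume

/-- The character `e^{i k·x}` on the `d`-torus. -/
def torusChar {d : ℕ} (k : ZLat d) (x : Torus d) : ℂ :=
  ∏ j, fourier (k j) (x j)

/-- The `k`-th Fourier coefficient `f̂(k) = (2π)^{-d} ∫_{𝕋^d} f(x) e^{-i k·x} dx`. -/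
def fourierCoef {d : ℕ} (f : Torus d → ℂ) (k : ZLat d) : ℂ :=
  ∫ x, (starRingEnd ℂ) (torusChar k x) * f x ∂(torusMeasure d)

/-- The `n`-th approximation number of a bounded linear operator `T`:
`a_n(T) = inf {‖T - A‖ : rank A < n}`. -/
def approxNum {X Y : Type*} [NormedAddCommGroup X] [NormedSpace ℂ X]
    [NormedAddCommGroup Y] [NormedSpace ℂ Y] (T : X →L[ℂ] Y) (n : ℕ) : ℝ :=
  sInf {c : ℝ | ∃ A : X →L[ℂ] Y,
    Module.rank ℂ (LinearMap.range (A : X →ₗ[ℂ] Y)) < n ∧ c = ‖T - A‖}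

/-- `ℓ²(ℤ^d)`; an isometric model of the Hilbert space `F_d(w)` via `f ↦ (w(k)·f̂(k))_k`.
Under this identification the embedding `I_d : F_d(w) → G` is characterized by the
property that the function `T c` has Fourier coefficients `c(k)/w(k)`. -/
abbrev ellTwo (d : ℕ) := lp (fun _ : ZLat d => ℂ) 2

/-- `ℓ¹(ℤ^d)`; an isometric model of the Wiener algebra `A(𝕋^d)` via `f ↦ (f̂(k))_k`. -/
abbrev ellOne (d : ℕ) := lp (fun _ : ZLat d => ℂ) 1

/-- `ℓ^∞(ℤ^d)`; an isometric model of the space `ℬ(𝕋^d)` of distributions with bounded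
Fourier coefficients. -/
abbrev ellInfty (d : ℕ) := lp (fun _ : ZLat d => ℂ) ⊤

/-- The weight `w^{mix}_{s,r}(k) = ∏_j (1+|k_j|^r)^{s/r}` of the Sobolev space of
dominating mixed smoothness `H^{s,r}_mix(𝕋^d) = F_d(w^{mix}_{s,r})`. -/
def wMix (d : ℕ) (s r : ℝ) (k : ZLat d) : ℝ := ∏ j, (1 + |(k j : ℝ)| ^ r) ^ (s / r)

/-- The `s = 1` weight `∏_j (1+|k_j|^r)^{1/r}`. -/
def mixNorm (r : ℝ) {d : ℕ} (k : ZLat d) : ℝ := ∏ j, (1 + |(k j : ℝ)| ^ r) ^ (1 / r)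

lemma one_le_mixNorm_factor {r : ℝ} (hr : 0 < r) (m : ℤ) :
    1 ≤ (1 + |(m : ℝ)| ^ r) ^ (1 / r) := by
  apply Real.one_le_rpow _ (by positivity)
  have : 0 ≤ |(m : ℝ)| ^ r := by positivity
  linarith

lemma abs_le_mixNorm_factor {r : ℝ} (hr : 0 < r) (m : ℤ) :
    |(m : ℝ)| ≤ (1 + |(m : ℝ)| ^ r) ^ (1 / r) := by
  calc |(m : ℝ)| = (|(m : ℝ)| ^ r) ^ (1 / r) := by
        rw [← Real.rpow_mul (abs_nonneg _), mul_one_div_cancel hr.ne', Real.rpow_one]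
    _ ≤ _ := by
        apply Real.rpow_le_rpow (by positivity) (by linarith) (by positivity)

lemma one_le_mixNorm {r : ℝ} (hr : 0 < r) {d : ℕ} (k : ZLat d) : 1 ≤ mixNorm r k :=
  Finset.one_le_prod fun j _ => one_le_mixNorm_factor hr (k j)

lemma mixNorm_pos {r : ℝ} (hr : 0 < r) {d : ℕ} (k : ZLat d) : 0 < mixNorm r k :=
  zero_lt_one.trans_le (one_le_mixNorm hr k)

lemma abs_le_mixNorm {r : ℝ} (hr : 0 < r) {d : ℕ} (k : ZLat d) (j : Fin d) :
    |(k j : ℝ)| ≤ mixNorm r k := by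
  refine (abs_le_mixNorm_factor hr (k j)).trans ?_
  unfold mixNorm
  rw [← Finset.mul_prod_erase _ _ (Finset.mem_univ j)]
  refine le_mul_of_one_le_right (by positivity) ?_
  exact Finset.one_le_prod fun i _ => one_le_mixNorm_factor hr (k i)

lemma mixNorm_eq_mul_tail (r : ℝ) {d : ℕ} (k : ZLat (d + 1)) :
    mixNorm r k = (1 + |(k 0 : ℝ)| ^ r) ^ (1 / r) * mixNorm r (Fin.tail k : ZLat d) := by
  unfold mixNorm
  rw [Fin.prod_univ_succ]
  rfl

lemma wMix_eq_mixNorm_rpow {r : ℝ} (hr : 0 < r) (s : ℝ) {d : ℕ} (k : ZLat d) :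
    wMix d s r k = mixNorm r k ^ s := by
  unfold wMix mixNorm
  rw [← Real.finsetProd_rpow]
  · refine Finset.prod_congr rfl fun j _ => ?_
    rw [← Real.rpow_mul (by positivity)]
    congr 1
    field_simp
  · intro j _
    positivity

/-- The hyperbolic cross `{k : mixNorm r k ≤ x}`. -/
def hypCross (r : ℝ) (d : ℕ) (x : ℝ) : Finset (ZLat d) :=
  (Fintype.piFinset fun _ => Finset.Icc (-⌊x⌋) ⌊x⌋).filter fun k => mixNorm r k ≤ x

lemma mem_hypCross {r : ℝ} (hr : 0 < r) {d : ℕ} {x : ℝ} {k : ZLat d} :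
    k ∈ hypCross r d x ↔ mixNorm r k ≤ x := by
  unfold hypCross
  rw [Finset.mem_filter, Fintype.mem_piFinset, and_iff_right_iff_imp]
  intro h j
  have := (abs_le_mixNorm hr k j).trans h
  rw [abs_le] at this
  rw [Finset.mem_Icc, neg_le, Int.le_floor, Int.le_floor]
  push_cast
  constructor <;> linarith

/-- The cardinality of the hyperbolic cross. -/
def crossCard (r : ℝ) (d : ℕ) (x : ℝ) : ℝ := ((hypCross r d x).card : ℝ)

/-- The sum of `1 / mixNorm` over the hyperbolic cross. -/
def crossHarm (r : ℝ) (d : ℕ) (x : ℝ) : ℝ := ∑ k ∈ hypCross r d x, (mixNorm r k)⁻¹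

lemma hypCross_mono {r : ℝ} (hr : 0 < r) (d : ℕ) : Monotone (hypCross r d) := by
  intro x y h k hk
  rw [mem_hypCross hr] at *
  exact hk.trans h

lemma crossCard_mono {r : ℝ} (hr : 0 < r) (d : ℕ) : Monotone (crossCard r d) := by
  intro x y h
  unfold crossCard
  exact_mod_cast Finset.card_le_card (hypCross_mono hr d h)

lemma crossCard_nonneg (r : ℝ) (d : ℕ) (x : ℝ) : 0 ≤ crossCard r d x := by
  unfold crossCard; positivity

lemma sum_hypCross_ite {r : ℝ} (hr : 0 < r) (d : ℕ) {u x : ℝ} (h : u ≤ x) (c : ℝ) :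
    ∑ k ∈ hypCross r d x, (if mixNorm r k ≤ u then c else 0) = crossCard r d u * c := by
  rw [← Finset.sum_filter, Finset.sum_const, nsmul_eq_mul, crossCard]
  congr 3
  ext k
  simp only [Finset.mem_filter, mem_hypCross hr]
  exact ⟨fun h => h.2, fun h' => ⟨h'.trans h, h'⟩⟩

lemma intervalIntegrable_inv_sq {a b : ℝ} (ha : 0 < a) (hb : 0 < b) :
    IntervalIntegrable (fun u : ℝ => (u ^ 2)⁻¹) volume a b := by
  apply ContinuousOn.intervalIntegrable
  apply ContinuousOn.inv₀ (by fun_prop)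
  intro u hu
  have : 0 < u := (lt_min ha hb).trans_le hu.1
  positivity

lemma integral_inv_sq {a b : ℝ} (ha : 0 < a) (hb : 0 < b) :
    ∫ u in a..b, (u ^ 2)⁻¹ = a⁻¹ - b⁻¹ := by
  have h : ∀ u ∈ Set.uIcc a b, HasDerivAt (fun u : ℝ => -u⁻¹) ((u ^ 2)⁻¹) u := by
    intro u hu
    have : 0 < u := (lt_min ha hb).trans_le hu.1
    exact (hasDerivAt_inv this.ne').neg.congr_deriv (by simp)
  rw [intervalIntegral.integral_eq_sub_of_hasDerivAt h (intervalIntegrable_inv_sq ha hb)]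
  ring

lemma intervalIntegrable_ite {g x : ℝ} (hx : 1 ≤ x) :
    IntervalIntegrable (fun u : ℝ => if g ≤ u then (u ^ 2)⁻¹ else 0) volume 1 x := by
  have := (intervalIntegrable_inv_sq one_pos (zero_lt_one.trans_le hx)).1.indicator
    (measurableSet_Ici (a := g))
  refine ⟨?_, ?_⟩
  · convert! this using 1
  · rw [Set.Ioc_eq_empty (by linarith)]
    exact integrableOn_empty

lemma inv_eq_inv_add_integral {g x : ℝ} (hg : 1 ≤ g) (hx : g ≤ x) :
    g⁻¹ = x⁻¹ + ∫ u in (1 : ℝ)..x, if g ≤ u then (u ^ 2)⁻¹ else 0 := by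
  have h0 : (0 : ℝ) < g := by linarith
  have h1 : ∫ u in (1 : ℝ)..x, (if g ≤ u then (u ^ 2)⁻¹ else 0) = ∫ u in g..x, (u ^ 2)⁻¹ := by
    rw [intervalIntegral.integral_of_le (by linarith), intervalIntegral.integral_of_le hx,
      ← integral_Icc_eq_integral_Ioc (x := g)]
    have : (fun u : ℝ => if g ≤ u then (u ^ 2)⁻¹ else 0) =
        (Set.Ici g).indicator fun u => (u ^ 2)⁻¹ := by
      ext u; simp [Set.indicator]
    rw [this, setIntegral_indicator measurableSet_Ici]
    rcases hg.eq_or_lt with rfl | hg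
    · rw [integral_Icc_eq_integral_Ioc]
      congr 2
      ext u; simp; intro h _; exact h.le
    · congr 2
      ext u; simp; constructor
      · rintro ⟨⟨a, b⟩, c⟩; exact ⟨c, b⟩
      · rintro ⟨a, b⟩; exact ⟨⟨by linarith, b⟩, a⟩
  rw [h1, integral_inv_sq h0 (by linarith)]
  ring

lemma intervalIntegrable_crossCard {r : ℝ} (hr : 0 < r) (d : ℕ) {x : ℝ} (hx : 1 ≤ x) :
    IntervalIntegrable (fun u : ℝ => crossCard r d u * (u ^ 2)⁻¹) volume 1 x := by
  refine (IntervalIntegrable.sum (hypCross r d x)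
    (f := fun k u => if mixNorm r k ≤ u then (u ^ 2)⁻¹ else 0)
    fun k _ => intervalIntegrable_ite hx).congr ?_
  intro u hu
  rw [Set.uIoc_of_le hx] at hu
  rw [Finset.sum_apply]
  exact sum_hypCross_ite hr d hu.2 _

lemma crossHarm_eq {r : ℝ} (hr : 0 < r) (d : ℕ) {x : ℝ} (hx : 1 ≤ x) :
    crossHarm r d x = crossCard r d x * x⁻¹ +
      ∫ u in (1 : ℝ)..x, crossCard r d u * (u ^ 2)⁻¹ := by
  unfold crossHarm
  have h1 : ∀ k ∈ hypCross r d x, (mixNorm r k)⁻¹ =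
      x⁻¹ + ∫ u in (1 : ℝ)..x, if mixNorm r k ≤ u then (u ^ 2)⁻¹ else 0 := fun k hk =>
    inv_eq_inv_add_integral (one_le_mixNorm hr k) ((mem_hypCross hr).1 hk)
  rw [Finset.sum_congr rfl h1, Finset.sum_add_distrib, Finset.sum_const, nsmul_eq_mul,
    ← intervalIntegral.integral_finsetSum fun k _ => intervalIntegrable_ite hx]
  congr 1
  apply intervalIntegral.integral_congr
  intro u hu
  rw [Set.uIcc_of_le hx] at hu
  exact sum_hypCross_ite hr d hu.2 _

/-- The number of `m ∈ ℤ` with `(1+|m|^r)^{1/r} ≤ x`, for `x ≥ 1`. -/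
def lineCard (r x : ℝ) : ℝ := 2 * (⌊(x ^ r - 1) ^ (1 / r)⌋ : ℝ) + 1

lemma mixNorm_factor_le_iff {r : ℝ} (hr : 0 < r) {z : ℝ} (hz : 1 ≤ z) (m : ℤ) :
    (1 + |(m : ℝ)| ^ r) ^ (1 / r) ≤ z ↔
      m ∈ Finset.Icc (-⌊(z ^ r - 1) ^ (1 / r)⌋) ⌊(z ^ r - 1) ^ (1 / r)⌋ := by
  have h1 : 1 ≤ z ^ r := Real.one_le_rpow hz hr.le
  rw [Finset.mem_Icc, neg_le, Int.le_floor, Int.le_floor, one_div,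
    Real.rpow_inv_le_iff_of_pos (by positivity) (by positivity) hr,
    ← le_sub_iff_add_le', ← Real.le_rpow_inv_iff_of_pos (by positivity) (by linarith) hr, abs_le]
  push_cast
  constructor
  · rintro ⟨h, h'⟩; constructor <;> linarith
  · rintro ⟨h, h'⟩; constructor <;> linarith

lemma crossCard_succ {r : ℝ} (hr : 0 < r) (d : ℕ) (x : ℝ) :
    crossCard r (d + 1) x = ∑ k ∈ hypCross r d x, lineCard r (x / mixNorm r k) := by
  have hmaps : Set.MapsTo (fun k : ZLat (d + 1) => (Fin.tail k : ZLat d))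
      (hypCross r (d + 1) x) (hypCross r d x) := by
    intro k hk
    rw [Finset.mem_coe, mem_hypCross hr] at *
    refine le_trans ?_ hk
    rw [mixNorm_eq_mul_tail]
    exact le_mul_of_one_le_left (mixNorm_pos hr _).le (one_le_mixNorm_factor hr _)
  unfold crossCard
  rw [Finset.card_eq_sum_card_fiberwise hmaps]
  push_cast
  refine Finset.sum_congr rfl fun k hk => ?_
  have hk' := (mem_hypCross hr).1 hk
  have hz : 1 ≤ x / mixNorm r k := (one_le_div (mixNorm_pos hr k)).2 hk'
  set z := x / mixNorm r k with hzdef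
  have himg : {a ∈ hypCross r (d + 1) x | (Fin.tail a : ZLat d) = k} =
      (Finset.Icc (-⌊(z ^ r - 1) ^ (1 / r)⌋) ⌊(z ^ r - 1) ^ (1 / r)⌋).image
        fun m => (Fin.cons m k : ZLat (d + 1)) := by
    ext a
    simp only [Finset.mem_filter, Finset.mem_image, ← mixNorm_factor_le_iff hr hz,
      mem_hypCross hr, mixNorm_eq_mul_tail]
    constructor
    · rintro ⟨h, rfl⟩
      refine ⟨a 0, ?_, Fin.cons_self_tail a⟩
      rw [hzdef, le_div_iff₀ (mixNorm_pos hr _)]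
      exact h
    · rintro ⟨m, h, rfl⟩
      rw [hzdef, le_div_iff₀ (mixNorm_pos hr _)] at h
      simpa using h
  have h0 : 0 ≤ ⌊(z ^ r - 1) ^ (1 / r)⌋ := by
    apply Int.floor_nonneg.2
    have h1 : 1 ≤ z ^ r := Real.one_le_rpow hz hr.le
    exact Real.rpow_nonneg (by linarith) _
  rw [himg, Finset.card_image_of_injective, Int.card_Icc, lineCard]
  · have : ((⌊(z ^ r - 1) ^ (1 / r)⌋ + 1 - -⌊(z ^ r - 1) ^ (1 / r)⌋).toNat : ℤ) =
        2 * ⌊(z ^ r - 1) ^ (1 / r)⌋ + 1 := by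
      rw [Int.toNat_of_nonneg (by linarith)]; ring
    exact_mod_cast this
  · intro a b hab
    simpa using congrFun hab 0

lemma tendsto_lineCard_div {r : ℝ} (hr : 0 < r) :
    Tendsto (fun x => lineCard r x / x) atTop (nhds 2) := by
  have h1 : Tendsto (fun x : ℝ => (x ^ r - 1) ^ (1 / r) / x) atTop (nhds 1) := by
    have h2 : Tendsto (fun x : ℝ => (1 - x ^ (-r)) ^ (1 / r)) atTop (nhds 1) := by
      have := (tendsto_const_nhds (x := (1 : ℝ))).sub (tendsto_rpow_neg_atTop hr)
      have h3 := this.rpow_const (p := 1 / r) (Or.inl (by norm_num))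
      simpa using h3
    refine h2.congr' ?_
    filter_upwards [eventually_ge_atTop 1] with x hx
    have hx0 : 0 < x := by linarith
    have h1 : 1 ≤ x ^ r := Real.one_le_rpow hx hr.le
    have : x ^ r - 1 = x ^ r * (1 - x ^ (-r)) := by
      rw [mul_sub, ← Real.rpow_add hx0]; simp
    have h4 : 0 ≤ 1 - x ^ (-r) := by
      have := Real.rpow_le_one_of_one_le_of_nonpos hx (neg_nonpos.2 hr.le)
      linarith
    rw [this, Real.mul_rpow (by positivity) h4, ← Real.rpow_mul hx0.le,
      mul_one_div_cancel hr.ne', Real.rpow_one]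
    field_simp
  have hinv := tendsto_inv_atTop_zero (𝕜 := ℝ)
  have hl : Tendsto (fun x : ℝ => 2 * ((x ^ r - 1) ^ (1 / r) / x) - x⁻¹) atTop (nhds 2) := by
    simpa using (h1.const_mul 2).sub hinv
  have hu : Tendsto (fun x : ℝ => 2 * ((x ^ r - 1) ^ (1 / r) / x) + x⁻¹) atTop (nhds 2) := by
    simpa using (h1.const_mul 2).add hinv
  refine tendsto_of_tendsto_of_tendsto_of_le_of_le' hl hu ?_ ?_
  · filter_upwards [eventually_gt_atTop 0] with x hx
    have := Int.sub_one_lt_floor ((x ^ r - 1) ^ (1 / r))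
    rw [lineCard, le_div_iff₀ hx]
    field_simp
    linarith
  · filter_upwards [eventually_gt_atTop 0] with x hx
    have := Int.floor_le ((x ^ r - 1) ^ (1 / r))
    rw [lineCard, div_le_iff₀ hx]
    field_simp
    linarith

lemma lineCard_bounds {r : ℝ} (hr : 0 < r) {x : ℝ} (hx : 1 ≤ x) :
    0 ≤ lineCard r x ∧ lineCard r x ≤ 2 * x + 1 := by
  have h1 : 1 ≤ x ^ r := Real.one_le_rpow hx hr.le
  have h0 : 0 ≤ (x ^ r - 1) ^ (1 / r) := Real.rpow_nonneg (by linarith) _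
  have h2 : (x ^ r - 1) ^ (1 / r) ≤ x := by
    calc _ ≤ (x ^ r) ^ (1 / r) := Real.rpow_le_rpow (by linarith) (by linarith) (by positivity)
      _ = x := by rw [← Real.rpow_mul (by linarith), mul_one_div_cancel hr.ne', Real.rpow_one]
  have h3 := Int.floor_le ((x ^ r - 1) ^ (1 / r))
  have h4 : (0 : ℝ) ≤ ⌊(x ^ r - 1) ^ (1 / r)⌋ := by exact_mod_cast Int.floor_nonneg.2 h0
  unfold lineCard
  constructor <;> linarith

lemma tendsto_div_of_forall_error {f g h : ℝ → ℝ} {a : ℝ}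
    (H : ∀ ε > 0, ∃ K, ∀ᶠ x in atTop, |f x - a * g x| ≤ ε * g x + K * h x)
    (hg : ∀ᶠ x in atTop, 0 < g x) (hh : Tendsto (fun x => h x / g x) atTop (nhds 0)) :
    Tendsto (fun x => f x / g x) atTop (nhds a) := by
  rw [Metric.tendsto_nhds]
  intro ε hε
  obtain ⟨K, hK⟩ := H (ε / 2) (by positivity)
  have h2 : ∀ᶠ x in atTop, K * (h x / g x) < ε / 2 := by
    have := hh.const_mul K
    rw [mul_zero] at this
    exact this.eventually_lt_const (by positivity)
  filter_upwards [hK, hg, h2] with x h1 h3 h4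
  rw [Real.dist_eq]
  have : f x / g x - a = (f x - a * g x) / g x := by field_simp
  rw [this, abs_div, abs_of_pos h3, div_lt_iff₀ h3]
  rw [mul_div_assoc', div_lt_iff₀ h3] at h4
  linarith

lemma exists_error_bound {f g : ℝ → ℝ} {a : ℝ}
    (hf : Tendsto (fun x => f x / g x) atTop (nhds a))
    (hg : ∀ᶠ x in atTop, 0 < g x) (hg0 : ∀ x, 1 ≤ x → 0 ≤ g x)
    (hb : ∀ x₀, ∃ K, ∀ x, 1 ≤ x → x ≤ x₀ → |f x| ≤ K ∧ g x ≤ K) {ε : ℝ} (hε : 0 < ε) :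
    ∃ K, 0 ≤ K ∧ ∀ x, 1 ≤ x → |f x - a * g x| ≤ ε * g x + K := by
  have h1 := (Metric.tendsto_nhds.1 hf) ε hε
  obtain ⟨x₀, hx₀⟩ := eventually_atTop.1 (h1.and hg)
  obtain ⟨K, hK⟩ := hb x₀
  refine ⟨|K| + |a| * |K|, by positivity, fun x hx => ?_⟩
  have hgx := hg0 x hx
  rcases le_total x₀ x with h | h
  · obtain ⟨h2, h3⟩ := hx₀ x h
    rw [Real.dist_eq] at h2
    have : f x / g x - a = (f x - a * g x) / g x := by field_simp
    rw [this, abs_div, abs_of_pos h3, div_lt_iff₀ h3] at h2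
    have : 0 ≤ |K| + |a| * |K| := by positivity
    linarith
  · obtain ⟨h2, h3⟩ := hK x hx h
    calc |f x - a * g x| ≤ |f x| + |a * g x| := abs_sub _ _
      _ = |f x| + |a| * g x := by rw [abs_mul, abs_of_nonneg hgx]
      _ ≤ |K| + |a| * |K| := by
        have h4 := h2.trans (le_abs_self K)
        have h5 := h3.trans (le_abs_self K)
        gcongr
      _ ≤ _ := by
        have : 0 ≤ ε * g x := by positivity
        linarith

lemma lineCard_error {r : ℝ} (hr : 0 < r) {ε : ℝ} (hε : 0 < ε) :
    ∃ K, 0 ≤ K ∧ ∀ x, 1 ≤ x → |lineCard r x - 2 * x| ≤ ε * x + K := by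
  refine exists_error_bound (tendsto_lineCard_div hr) (eventually_gt_atTop 0)
    (fun x hx => by linarith) (fun x₀ => ⟨2 * x₀ + 1, fun x hx hx' => ?_⟩) hε
  obtain ⟨h1, h2⟩ := lineCard_bounds hr hx
  rw [abs_of_nonneg h1]
  constructor <;> linarith

lemma eventually_log_pow_pos (D : ℕ) : ∀ᶠ x : ℝ in atTop, 0 < Real.log x ^ D := by
  filter_upwards [eventually_gt_atTop 1] with x hx
  have := Real.log_pos hx
  positivity

lemma crossCard_error {r : ℝ} (hr : 0 < r) {d D : ℕ} {c : ℝ}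
    (h : Tendsto (fun x => crossCard r d x / (x * Real.log x ^ D)) atTop (nhds c))
    {ε : ℝ} (hε : 0 < ε) :
    ∃ K, 0 ≤ K ∧ ∀ x, 1 ≤ x →
      |crossCard r d x - c * (x * Real.log x ^ D)| ≤ ε * (x * Real.log x ^ D) + K := by
  refine exists_error_bound h ?_ ?_ (fun x₀ => ?_) hε
  · filter_upwards [eventually_log_pow_pos D, eventually_gt_atTop 0] with x h1 h2
    positivity
  · intro x hx
    have := Real.log_nonneg hx
    positivity
  · refine ⟨max (crossCard r d x₀) (x₀ * Real.log x₀ ^ D), fun x hx hx' => ?_⟩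
    have h1 := Real.log_nonneg hx
    rw [abs_of_nonneg (crossCard_nonneg r d x)]
    refine ⟨le_max_of_le_left (crossCard_mono hr d hx'), le_max_of_le_right ?_⟩
    have : 0 ≤ x₀ := by linarith
    gcongr

lemma integral_log_pow_div {x : ℝ} (hx : 1 ≤ x) (D : ℕ) :
    ∫ u in (1 : ℝ)..x, Real.log u ^ D * u⁻¹ = Real.log x ^ (D + 1) / (D + 1) := by
  have h : ∀ u ∈ Set.uIcc 1 x, HasDerivAt (fun u : ℝ => Real.log u ^ (D + 1) / (D + 1))
      (Real.log u ^ D * u⁻¹) u := by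
    intro u hu
    rw [Set.uIcc_of_le hx] at hu
    have hu0 : u ≠ 0 := by linarith [hu.1]
    refine (((Real.hasDerivAt_log hu0).pow (D + 1)).div_const _).congr_deriv ?_
    push_cast
    field_simp
  rw [intervalIntegral.integral_eq_sub_of_hasDerivAt h]
  · simp
  · apply ContinuousOn.intervalIntegrable
    intro u hu
    rw [Set.uIcc_of_le hx] at hu
    have hu0 : u ≠ 0 := by linarith [hu.1]
    apply ContinuousAt.continuousWithinAt
    fun_prop (disch := assumption)

lemma intervalIntegrable_log_pow_div {x : ℝ} (hx : 1 ≤ x) (D : ℕ) :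
    IntervalIntegrable (fun u => Real.log u ^ D * u⁻¹) volume 1 x := by
  apply ContinuousOn.intervalIntegrable
  intro u hu
  rw [Set.uIcc_of_le hx] at hu
  have hu0 : u ≠ 0 := by linarith [hu.1]
  apply ContinuousAt.continuousWithinAt
  fun_prop (disch := assumption)

lemma tendsto_crossHarm {r : ℝ} (hr : 0 < r) {d D : ℕ} {c : ℝ}
    (h : Tendsto (fun x => crossCard r d x / (x * Real.log x ^ D)) atTop (nhds c)) :
    Tendsto (fun x => crossHarm r d x / Real.log x ^ (D + 1)) atTop (nhds (c / (D + 1))) := by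
  have hlog : Tendsto (fun x : ℝ => (Real.log x)⁻¹) atTop (nhds 0) :=
    tendsto_inv_atTop_zero.comp Real.tendsto_log_atTop
  have hmain : Tendsto (fun x => (∫ u in (1 : ℝ)..x, crossCard r d u * (u ^ 2)⁻¹) /
      Real.log x ^ (D + 1)) atTop (nhds (c / (D + 1))) := by
    refine tendsto_div_of_forall_error (h := fun _ => 1) (fun ε hε => ?_)
      (eventually_log_pow_pos _) ?_
    · obtain ⟨K, hK0, hK⟩ := crossCard_error hr h hε
      refine ⟨K, ?_⟩
      filter_upwards [eventually_ge_atTop 1] with x hx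
      have hi1 := intervalIntegrable_crossCard hr d hx
      have hi2 := (intervalIntegrable_log_pow_div hx D).const_mul c
      have hi3 := (intervalIntegrable_log_pow_div hx D).const_mul ε
      have hi4 := (intervalIntegrable_inv_sq one_pos (zero_lt_one.trans_le hx)).const_mul K
      have e1 : c / (D + 1) * Real.log x ^ (D + 1) =
          ∫ u in (1 : ℝ)..x, c * (Real.log u ^ D * u⁻¹) := by
        rw [intervalIntegral.integral_const_mul, integral_log_pow_div hx]; ring
      rw [e1, ← intervalIntegral.integral_sub hi1 hi2]
      have hbd : ‖∫ u in (1 : ℝ)..x, (crossCard r d u * (u ^ 2)⁻¹ - c * (Real.log u ^ D * u⁻¹))‖ ≤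
          ∫ u in (1 : ℝ)..x, (ε * (Real.log u ^ D * u⁻¹) + K * (u ^ 2)⁻¹) := by
        apply intervalIntegral.norm_integral_le_of_norm_le hx _ (hi3.add hi4)
        refine ae_of_all _ fun u hu => ?_
        have hu0 : 0 < u := by linarith [hu.1]
        have := hK u hu.1.le
        rw [Real.norm_eq_abs]
        have e2 : crossCard r d u * (u ^ 2)⁻¹ - c * (Real.log u ^ D * u⁻¹) =
            (crossCard r d u - c * (u * Real.log u ^ D)) * (u ^ 2)⁻¹ := by
          field_simp
        have e3 : ε * (Real.log u ^ D * u⁻¹) + K * (u ^ 2)⁻¹ =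
            (ε * (u * Real.log u ^ D) + K) * (u ^ 2)⁻¹ := by
          field_simp
        rw [e2, e3, abs_mul, abs_of_pos (a := (u ^ 2)⁻¹) (by positivity)]
        gcongr
      rw [Real.norm_eq_abs] at hbd
      refine hbd.trans ?_
      rw [intervalIntegral.integral_add hi3 hi4, intervalIntegral.integral_const_mul,
        intervalIntegral.integral_const_mul, integral_log_pow_div hx,
        integral_inv_sq one_pos (by linarith)]
      have hl := Real.log_nonneg hx
      have : (1 : ℝ)⁻¹ - x⁻¹ ≤ 1 := by
        have : 0 ≤ x⁻¹ := by positivity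
        rw [inv_one]; linarith
      gcongr
      apply div_le_self (by positivity)
      have : (0 : ℝ) ≤ D := by positivity
      linarith
    · have := hlog.pow (D + 1)
      simpa using this
  have hfirst : Tendsto (fun x => crossCard r d x / (x * Real.log x ^ D) * (Real.log x)⁻¹)
      atTop (nhds 0) := by simpa using h.mul hlog
  have := hfirst.add hmain
  rw [zero_add] at this
  refine this.congr' ?_
  filter_upwards [eventually_gt_atTop 1] with x hx
  have := Real.log_pos hx
  rw [crossHarm_eq hr d hx.le]
  field_simp
  ring

lemma crossCard_succ_error {r : ℝ} (hr : 0 < r) (d : ℕ) {ε : ℝ} (hε : 0 < ε) :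
    ∃ K, ∀ᶠ x in atTop, |crossCard r (d + 1) x - 2 * (x * crossHarm r d x)| ≤
      ε * (x * crossHarm r d x) + K * crossCard r d x := by
  obtain ⟨K, hK0, hK⟩ := lineCard_error hr hε
  refine ⟨K, Eventually.of_forall fun x => ?_⟩
  have e : ∀ a : ℝ, a * (x * crossHarm r d x) =
      ∑ k ∈ hypCross r d x, a * (x / mixNorm r k) := by
    intro a
    simp only [crossHarm, Finset.mul_sum, div_eq_mul_inv]
  have e' : K * crossCard r d x = ∑ k ∈ hypCross r d x, K := by
    rw [crossCard, Finset.sum_const, nsmul_eq_mul, mul_comm]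
  rw [crossCard_succ hr, e 2, e ε, e', ← Finset.sum_sub_distrib, ← Finset.sum_add_distrib]
  refine (Finset.abs_sum_le_sum_abs _ _).trans (Finset.sum_le_sum fun k hk => hK _ ?_)
  exact (one_le_div (mixNorm_pos hr k)).2 ((mem_hypCross hr).1 hk)

lemma hypCross_zero {r : ℝ} (hr : 0 < r) {x : ℝ} (hx : 1 ≤ x) :
    hypCross r 0 x = Finset.univ := by
  ext k
  simpa [mem_hypCross hr, mixNorm, hx] using Subsingleton.elim _ _

/-- Asymptotics of the number of lattice points in a hyperbolic cross. -/
theorem tendsto_crossCard {r : ℝ} (hr : 0 < r) (D : ℕ) :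
    Tendsto (fun x => crossCard r (D + 1) x / (x * Real.log x ^ D)) atTop
      (nhds (2 ^ (D + 1) / (Nat.factorial D : ℝ))) := by
  induction D with
  | zero =>
    simp only [zero_add, pow_zero, mul_one, pow_one, Nat.factorial_zero, Nat.cast_one, div_one]
    refine (tendsto_lineCard_div hr).congr' ?_
    filter_upwards [eventually_ge_atTop 1] with x hx
    rw [← zero_add 1, crossCard_succ hr, hypCross_zero hr hx]
    simp [mixNorm]
  | succ D ih =>
    have hH := tendsto_crossHarm hr ih
    have hpos : ∀ᶠ x in atTop, 0 < crossHarm r (D + 1) x := by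
      have h1 : (0 : ℝ) < 2 ^ (D + 1) / (Nat.factorial D : ℝ) / (D + 1) := by positivity
      filter_upwards [hH.eventually_const_lt h1, eventually_log_pow_pos (D + 1)] with x h2 h3
      exact (div_pos_iff_of_pos_right h3).1 h2
    have hlog : Tendsto (fun x : ℝ => (Real.log x)⁻¹) atTop (nhds 0) :=
      tendsto_inv_atTop_zero.comp Real.tendsto_log_atTop
    have hq : Tendsto (fun x => crossCard r (D + 2) x / (x * crossHarm r (D + 1) x)) atTop
        (nhds 2) := by
      refine tendsto_div_of_forall_error (fun ε hε => crossCard_succ_error hr (D + 1) hε) ?_ ?_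
      · filter_upwards [hpos, eventually_gt_atTop 0] with x h1 h2
        positivity
      · have h1 := (ih.mul hlog).div hH (by positivity)
        simp only [mul_zero, zero_div] at h1
        refine h1.congr' ?_
        filter_upwards [hpos, eventually_gt_atTop 1] with x h2 h3
        have := Real.log_pos h3
        simp only [Pi.div_apply]
        field_simp
        ring
    have := hq.mul hH
    have e : (2 : ℝ) * (2 ^ (D + 1) / (Nat.factorial D : ℝ) / (D + 1)) =
        2 ^ (D + 1 + 1) / (Nat.factorial (D + 1) : ℝ) := by
      rw [Nat.factorial_succ]
      push_cast
      field_simp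
      ring
    rw [e] at this
    refine this.congr' ?_
    filter_upwards [hpos, eventually_gt_atTop 1] with x h2 h3
    have := Real.log_pos h3
    field_simp

/-- The sum of `mixNorm ^ (-2s)` outside the hyperbolic cross. -/
def crossTail (r s : ℝ) (d : ℕ) (x : ℝ) : ℝ :=
  ∑' k : ZLat d, if mixNorm r k ≤ x then 0 else mixNorm r k ^ (-(2 * s))

lemma integrableOn_ite_rpow {s : ℝ} (hs : 1 / 2 < s) (P : Prop) [Decidable P] (g x : ℝ) :
    IntegrableOn (fun v : ℝ => if P ∧ g ≤ x * v then 2 * s * v ^ (-(2 * s) - 1) else 0)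
      (Set.Ioi 1) := by
  have h := (integrableOn_Ioi_rpow_of_lt (a := -(2 * s) - 1) (by linarith) one_pos).const_mul
    (2 * s)
  have hm : MeasurableSet {v : ℝ | P ∧ g ≤ x * v} := by
    by_cases hP : P
    · simp only [hP, true_and]
      exact measurableSet_le measurable_const (measurable_const.mul measurable_id)
    · simp [hP]
  refine (IntegrableOn.indicator h hm).congr_fun (fun v _ => ?_) measurableSet_Ioi
  simp [Set.indicator]

lemma integral_ite_rpow {s : ℝ} (hs : 1 / 2 < s) {g x : ℝ} (hx : 0 < x) :
    ∫ v in Set.Ioi (1 : ℝ), (if x < g ∧ g ≤ x * v then 2 * s * v ^ (-(2 * s) - 1) else 0) =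
      x ^ (2 * s) * if g ≤ x then 0 else g ^ (-(2 * s)) := by
  split_ifs with h
  · simp [h.not_gt]
  · push Not at h
    have hgx : 1 < g / x := (one_lt_div hx).2 h
    have e1 : ∀ v : ℝ, (if x < g ∧ g ≤ x * v then 2 * s * v ^ (-(2 * s) - 1) else 0) =
        (Set.Ici (g / x)).indicator (fun v => 2 * s * v ^ (-(2 * s) - 1)) v := by
      intro v
      simp only [h, true_and, Set.indicator, Set.mem_Ici, div_le_iff₀' hx]
    have e2 : Set.Ioi (1 : ℝ) ∩ Set.Ici (g / x) = Set.Ici (g / x) :=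
      Set.inter_eq_right.2 fun v hv => hgx.trans_le hv
    simp_rw [e1]
    rw [setIntegral_indicator measurableSet_Ici, e2, integral_Ici_eq_integral_Ioi,
      integral_const_mul, integral_Ioi_rpow_of_lt (by linarith) (by linarith),
      Real.div_rpow (by linarith) hx.le, show -(2 * s) - 1 + 1 = -(2 * s) by ring,
      Real.rpow_neg hx.le]
    have : x ^ (2 * s) ≠ 0 := by positivity
    field_simp

lemma crossTail_eq {r s : ℝ} (hr : 0 < r) (hs : 1 / 2 < s) {d : ℕ}
    (hsum : Summable fun k : ZLat d => mixNorm r k ^ (-(2 * s))) {x : ℝ} (hx : 0 < x) :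
    x ^ (2 * s) * crossTail r s d x = ∫ v in Set.Ioi (1 : ℝ),
      (crossCard r d (x * v) - crossCard r d x) * (2 * s * v ^ (-(2 * s) - 1)) := by
  set F : ZLat d → ℝ → ℝ := fun k v =>
    if x < mixNorm r k ∧ mixNorm r k ≤ x * v then 2 * s * v ^ (-(2 * s) - 1) else 0 with hF
  have hFi : ∀ k, IntegrableOn (F k) (Set.Ioi 1) := fun k => integrableOn_ite_rpow hs _ _ _
  have hFint : ∀ k, ∫ v in Set.Ioi (1 : ℝ), F k v =
      x ^ (2 * s) * if mixNorm r k ≤ x then 0 else mixNorm r k ^ (-(2 * s)) :=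
    fun k => integral_ite_rpow hs hx
  have hFn : ∀ k, ∫ v in Set.Ioi (1 : ℝ), ‖F k v‖ =
      x ^ (2 * s) * if mixNorm r k ≤ x then 0 else mixNorm r k ^ (-(2 * s)) := by
    intro k
    rw [← hFint k]
    refine setIntegral_congr_fun measurableSet_Ioi fun v hv => ?_
    have hv0 : (0 : ℝ) < v := one_pos.trans hv
    simp only [hF]
    rw [Real.norm_of_nonneg]
    split_ifs
    · positivity
    · rfl
  have hs' : Summable fun k : ZLat d =>
      if mixNorm r k ≤ x then 0 else mixNorm r k ^ (-(2 * s)) := by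
    refine Summable.of_nonneg_of_le (fun k => ?_) (fun k => ?_) hsum
    · have := mixNorm_pos hr k
      split_ifs <;> positivity
    · have := mixNorm_pos hr k
      split_ifs
      · positivity
      · rfl
  have key := hasSum_integral_of_summable_integral_norm hFi (by
    simp_rw [hFn]
    exact hs'.mul_left _)
  have h1 := key.tsum_eq
  simp_rw [hFint] at h1
  rw [tsum_mul_left] at h1
  rw [crossTail, h1]
  refine setIntegral_congr_fun measurableSet_Ioi fun v hv => ?_
  have hv1 : (1 : ℝ) < v := hv
  have hxv : x ≤ x * v := le_mul_of_one_le_right hx.le hv1.le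
  have e : ∀ k, F k v = (if k ∈ hypCross r d (x * v) \ hypCross r d x then
      2 * s * v ^ (-(2 * s) - 1) else 0) := by
    intro k
    simp only [hF, Finset.mem_sdiff, mem_hypCross hr, not_le]
    congr 1
    rw [and_comm]
  simp only [e]
  rw [tsum_eq_sum (s := hypCross r d (x * v) \ hypCross r d x) (by
    intro k hk; rw [if_neg hk]), Finset.sum_ite_mem, Finset.inter_self, Finset.sum_const,
    nsmul_eq_mul, Finset.card_sdiff_of_subset (hypCross_mono hr d hxv),
    Nat.cast_sub (Finset.card_le_card (hypCross_mono hr d hxv))]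
  rfl

lemma crossCard_le {r : ℝ} (hr : 0 < r) (D : ℕ) :
    ∃ K, 0 ≤ K ∧ ∀ x, 1 ≤ x → crossCard r (D + 1) x ≤ K * (x * (1 + Real.log x) ^ D) := by
  set c : ℝ := 2 ^ (D + 1) / (Nat.factorial D : ℝ)
  have hc : 0 ≤ c := by positivity
  obtain ⟨K, hK0, hK⟩ := crossCard_error hr (tendsto_crossCard hr D) one_pos
  refine ⟨c + 1 + K, by positivity, fun x hx => ?_⟩
  have h1 := (abs_le.1 (hK x hx)).2
  have hl := Real.log_nonneg hx
  have h2 : x * Real.log x ^ D ≤ x * (1 + Real.log x) ^ D := by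
    gcongr
    linarith
  have h3 : 1 ≤ x * (1 + Real.log x) ^ D :=
    one_le_mul_of_one_le_of_one_le hx (one_le_pow₀ (by linarith))
  calc crossCard r (D + 1) x ≤ (c + 1) * (x * Real.log x ^ D) + K * 1 := by linarith
    _ ≤ (c + 1) * (x * (1 + Real.log x) ^ D) + K * (x * (1 + Real.log x) ^ D) := by gcongr
    _ = _ := by ring

lemma two_add_log_pow_le {δ : ℝ} (hδ : 0 < δ) (D : ℕ) :
    ∃ A, 0 ≤ A ∧ ∀ v, 1 ≤ v → (2 + Real.log v) ^ D ≤ A * v ^ δ := by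
  set η := δ / (D + 1) with hη
  have hη0 : 0 < η := by positivity
  refine ⟨(2 + 1 / η) ^ D, by positivity, fun v hv => ?_⟩
  have h1 : Real.log v ≤ v ^ η / η := Real.log_le_rpow_div (by linarith) hη0
  have h2 : 1 ≤ v ^ η := Real.one_le_rpow hv hη0.le
  have hl := Real.log_nonneg hv
  calc (2 + Real.log v) ^ D ≤ ((2 + 1 / η) * v ^ η) ^ D := by
        gcongr
        calc 2 + Real.log v ≤ 2 * v ^ η + v ^ η / η := by linarith
          _ = _ := by ring
    _ = (2 + 1 / η) ^ D * v ^ (η * D) := by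
        rw [mul_pow, Real.rpow_mul (by linarith), Real.rpow_natCast]
    _ ≤ _ := by
        have : η * D ≤ δ := by
          rw [hη, div_mul_eq_mul_div, div_le_iff₀ (by positivity)]
          nlinarith
        gcongr

lemma tendsto_log_mul_div_log {v : ℝ} (hv : 0 < v) :
    Tendsto (fun x => Real.log (x * v) / Real.log x) atTop (nhds 1) := by
  have hlog : Tendsto (fun x : ℝ => (Real.log x)⁻¹) atTop (nhds 0) :=
    tendsto_inv_atTop_zero.comp Real.tendsto_log_atTop
  have := (hlog.const_mul (Real.log v)).const_add 1
  rw [mul_zero, add_zero] at this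
  refine this.congr' ?_
  filter_upwards [eventually_gt_atTop 1] with x hx
  have := Real.log_pos hx
  rw [Real.log_mul (by linarith) hv.ne']
  field_simp

lemma tendsto_crossCard_mul {r : ℝ} (hr : 0 < r) (D : ℕ) {v : ℝ} (hv : 0 < v) :
    Tendsto (fun x => crossCard r (D + 1) (x * v) / (x * Real.log x ^ D)) atTop
      (nhds (2 ^ (D + 1) / (Nat.factorial D : ℝ) * v)) := by
  have h1 := (tendsto_crossCard hr D).comp (tendsto_id.atTop_mul_const hv)
  have h2 := (h1.mul ((tendsto_log_mul_div_log hv).pow D)).mul_const v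
  rw [one_pow, mul_one] at h2
  refine h2.congr' ?_
  have hxv : Tendsto (fun x : ℝ => x * v) atTop atTop := tendsto_id.atTop_mul_const hv
  filter_upwards [eventually_gt_atTop 1, hxv.eventually_gt_atTop 1] with x hx hx'
  have := Real.log_pos hx
  have := Real.log_pos hx'
  simp only [Function.comp, id, div_pow]
  field_simp

lemma integral_limit {s : ℝ} (hs : 1 / 2 < s) (c : ℝ) :
    ∫ v in Set.Ioi (1 : ℝ), (c * v - c) * (2 * s * v ^ (-(2 * s) - 1)) = c / (2 * s - 1) := by
  have e : ∀ v ∈ Set.Ioi (1 : ℝ), (c * v - c) * (2 * s * v ^ (-(2 * s) - 1)) =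
      2 * s * c * v ^ (-(2 * s)) - 2 * s * c * v ^ (-(2 * s) - 1) := by
    intro v hv
    have hv0 : (0 : ℝ) < v := one_pos.trans hv
    have : v ^ (-(2 * s)) = v * v ^ (-(2 * s) - 1) := by
      rw [← Real.rpow_one_add' hv0.le (by linarith)]
      congr 1; ring
    rw [this]; ring
  rw [setIntegral_congr_fun measurableSet_Ioi e, integral_sub, integral_const_mul,
    integral_const_mul, integral_Ioi_rpow_of_lt (by linarith) one_pos,
    integral_Ioi_rpow_of_lt (by linarith) one_pos]
  · have h1 : 2 * s - 1 ≠ 0 := by linarith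
    have h2 : -(2 * s) + 1 ≠ 0 := by linarith
    simp only [Real.one_rpow, sub_add_cancel]
    have h3 : s ≠ 0 := by linarith
    have h4 : -(2 * s) + 1 = -(2 * s - 1) := by ring
    rw [h4]
    field_simp
    ring
  · exact (integrableOn_Ioi_rpow_of_lt (by linarith) one_pos).const_mul _
  · exact (integrableOn_Ioi_rpow_of_lt (by linarith) one_pos).const_mul _

/-- Asymptotics of the sum of `mixNorm ^ (-2s)` outside the hyperbolic cross. -/
theorem tendsto_crossTail {r s : ℝ} (hr : 0 < r) (hs : 1 / 2 < s) (D : ℕ)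
    (hsum : Summable fun k : ZLat (D + 1) => mixNorm r k ^ (-(2 * s))) :
    Tendsto (fun x => crossTail r s (D + 1) x / (x ^ (1 - 2 * s) * Real.log x ^ D)) atTop
      (nhds (2 ^ (D + 1) / (Nat.factorial D : ℝ) / (2 * s - 1))) := by
  set c : ℝ := 2 ^ (D + 1) / (Nat.factorial D : ℝ) with hc
  obtain ⟨K, hK0, hK⟩ := crossCard_le hr D
  obtain ⟨A, hA0, hA⟩ := two_add_log_pow_le (δ := s - 1 / 2) (by linarith) D
  have key : Tendsto (fun x => ∫ v in Set.Ioi (1 : ℝ),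
      ((crossCard r (D + 1) (x * v) - crossCard r (D + 1) x) / (x * Real.log x ^ D)) *
        (2 * s * v ^ (-(2 * s) - 1))) atTop
      (nhds (∫ v in Set.Ioi (1 : ℝ), (c * v - c) * (2 * s * v ^ (-(2 * s) - 1)))) := by
    refine tendsto_integral_filter_of_dominated_convergence
      (fun v => K * A * (2 * s) * v ^ (-s - 1 / 2)) ?_ ?_ ?_ ?_
    · filter_upwards [eventually_gt_atTop 0] with x hx
      have hm : Measurable fun v => crossCard r (D + 1) (x * v) :=
        (crossCard_mono hr _).measurable.comp (measurable_const.mul measurable_id)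
      apply Measurable.aestronglyMeasurable
      fun_prop
    · filter_upwards [eventually_ge_atTop (Real.exp 1)] with x hx
      filter_upwards [ae_restrict_mem measurableSet_Ioi] with v hv
      have hv1 : (1 : ℝ) < v := hv
      have hx0 : 0 < x := (Real.exp_pos 1).trans_le hx
      have hx1 : 1 ≤ x := le_trans (by have := Real.add_one_le_exp (1 : ℝ); linarith) hx
      have hlx : 1 ≤ Real.log x := (Real.le_log_iff_exp_le hx0).2 hx
      have hlv := Real.log_nonneg hv1.le
      have hxv : x ≤ x * v := le_mul_of_one_le_right hx0.le hv1.le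
      have hmono := crossCard_mono hr (D + 1) hxv
      have h1 := hK (x * v) (hx1.trans hxv)
      have h2 := crossCard_nonneg r (D + 1) x
      have h3 : (1 + Real.log (x * v)) ^ D ≤ Real.log x ^ D * (A * v ^ (s - 1 / 2)) := by
        calc (1 + Real.log (x * v)) ^ D ≤ (Real.log x * (2 + Real.log v)) ^ D := by
              rw [Real.log_mul hx0.ne' (by linarith)]
              gcongr
              nlinarith
          _ ≤ _ := by
              rw [mul_pow]
              gcongr
              exact hA v hv1.le
      have h4 : v ^ (-s - 1 / 2) = v * v ^ (s - 1 / 2) * v ^ (-(2 * s) - 1) := by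
        rw [mul_assoc, ← Real.rpow_add (by linarith), ← Real.rpow_one_add' (by linarith)]
        · congr 1; ring
        · linarith
      rw [norm_mul, Real.norm_of_nonneg (r := 2 * s * _) (by positivity), Real.norm_of_nonneg
        (div_nonneg (by linarith) (by positivity)), h4]
      calc _ ≤ (K * A * (v * v ^ (s - 1 / 2))) * (2 * s * v ^ (-(2 * s) - 1)) := by
            gcongr
            rw [div_le_iff₀ (by positivity)]
            calc _ ≤ crossCard r (D + 1) (x * v) := by linarith
              _ ≤ _ := h1
              _ ≤ K * (x * v * (Real.log x ^ D * (A * v ^ (s - 1 / 2)))) := by gcongr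
              _ = _ := by ring
        _ = _ := by ring
    · exact (integrableOn_Ioi_rpow_of_lt (by linarith) one_pos).const_mul _
    · filter_upwards [ae_restrict_mem measurableSet_Ioi] with v hv
      have hv0 : (0 : ℝ) < v := one_pos.trans hv
      have := (tendsto_crossCard_mul hr D hv0).sub (tendsto_crossCard hr D)
      simp_rw [← sub_div] at this
      exact this.mul_const _
  rw [integral_limit hs] at key
  refine key.congr' ?_
  filter_upwards [eventually_gt_atTop 1] with x hx
  have hx0 : 0 < x := by linarith
  have hlx := Real.log_pos hx
  have e : ∀ v : ℝ, (crossCard r (D + 1) (x * v) - crossCard r (D + 1) x) / (x * Real.log x ^ D) *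
      (2 * s * v ^ (-(2 * s) - 1)) = (x * Real.log x ^ D)⁻¹ *
        ((crossCard r (D + 1) (x * v) - crossCard r (D + 1) x) *
      (2 * s * v ^ (-(2 * s) - 1))) := fun v => by ring
  simp_rw [e]
  rw [integral_const_mul, ← crossTail_eq hr hs hsum hx0, sub_eq_add_neg,
    Real.rpow_add hx0, Real.rpow_one, Real.rpow_neg hx0.le]
  have : x ^ (2 * s) ≠ 0 := by positivity
  field_simp

lemma tendsto_sub_one_div : Tendsto (fun x : ℝ => (x - 1) / x) atTop (nhds 1) := by
  have := (tendsto_inv_atTop_zero (𝕜 := ℝ)).const_sub 1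
  rw [sub_zero] at this
  refine this.congr' ?_
  filter_upwards [eventually_gt_atTop 0] with x hx
  field_simp

lemma tendsto_log_sub_one_div_log :
    Tendsto (fun x : ℝ => Real.log (x - 1) / Real.log x) atTop (nhds 1) := by
  have hlog : Tendsto (fun x : ℝ => (Real.log x)⁻¹) atTop (nhds 0) :=
    tendsto_inv_atTop_zero.comp Real.tendsto_log_atTop
  have := ((tendsto_sub_one_div.log one_ne_zero).mul hlog).const_add 1
  rw [mul_zero, add_zero] at this
  refine this.congr' ?_
  filter_upwards [eventually_gt_atTop 1] with x hx
  have := Real.log_pos hx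
  rw [Real.log_div (by linarith) (by linarith)]
  field_simp
  ring

/-- Passing from `f (x)` to `f (x - 1)` does not change asymptotics of the form
`x ^ p * log x ^ D`. -/
lemma tendsto_comp_sub_one {f : ℝ → ℝ} {p a : ℝ} {D : ℕ}
    (hf : Tendsto (fun x => f x / (x ^ p * Real.log x ^ D)) atTop (nhds a)) :
    Tendsto (fun x => f (x - 1) / (x ^ p * Real.log x ^ D)) atTop (nhds a) := by
  have hsub : Tendsto (fun x : ℝ => x - 1) atTop atTop :=
    tendsto_atTop_add_const_right _ _ tendsto_id
  have h1 := ((hf.comp hsub).mul (tendsto_sub_one_div.rpow_const (p := p)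
    (Or.inl one_ne_zero))).mul (tendsto_log_sub_one_div_log.pow D)
  rw [Real.one_rpow, one_pow, mul_one, mul_one] at h1
  refine h1.congr' ?_
  filter_upwards [eventually_gt_atTop 2] with x hx
  have := Real.log_pos (show 1 < x by linarith)
  have := Real.log_pos (show 1 < x - 1 by linarith)
  have hx1 : 0 < x - 1 := by linarith
  have hx0 : 0 < x := by linarith
  have h2 : (x - 1) ^ p ≠ 0 := by positivity
  have h3 : x ^ p ≠ 0 := by positivity
  rw [Real.div_rpow hx1.le hx0.le, div_pow]
  simp only [Function.comp]
  field_simp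

lemma tendsto_log_div_log_of_asymp {N m : ℕ → ℝ} {C : ℝ} {D : ℕ} (hC : 0 < C)
    (hm : Tendsto m atTop atTop)
    (h : Tendsto (fun n => N n / (m n * Real.log (m n) ^ D)) atTop (nhds C))
    (hN : ∀ᶠ n in atTop, 0 < N n) :
    Tendsto (fun n => Real.log (N n) / Real.log (m n)) atTop (nhds 1) := by
  have hlm : Tendsto (fun n => Real.log (m n)) atTop atTop := Real.tendsto_log_atTop.comp hm
  have h1 := (h.log hC.ne').mul (tendsto_inv_atTop_zero.comp hlm)
  have h2 := (Real.isLittleO_log_id_atTop.tendsto_div_nhds_zero.comp hlm).const_mul (D : ℝ)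
  have h3 := (h1.add h2).const_add 1
  rw [mul_zero, mul_zero, add_zero, add_zero] at h3
  refine h3.congr' ?_
  filter_upwards [hN, hm.eventually_gt_atTop 1] with n hn hmn
  have hl := Real.log_pos hmn
  have hm0 : 0 < m n := by linarith
  simp only [Function.comp, id]
  rw [Real.log_div hn.ne' (by positivity), Real.log_mul hm0.ne' (by positivity), Real.log_pow]
  field_simp
  ring

lemma tendsto_of_asymp {N m A : ℕ → ℝ} {C s : ℝ} {D : ℕ} (hC : 0 < C) (hs : 1 / 2 < s)
    (hm : Tendsto m atTop atTop)
    (h : Tendsto (fun n => N n / (m n * Real.log (m n) ^ D)) atTop (nhds C))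
    (hN : ∀ᶠ n in atTop, 1 < N n) (hA0 : ∀ n, 0 ≤ A n)
    (hA : Tendsto (fun n => A n ^ 2 / (m n ^ (1 - 2 * s) * Real.log (m n) ^ D)) atTop
      (nhds (C / (2 * s - 1)))) :
    Tendsto (fun n => N n ^ (s - 1 / 2) * A n / Real.log (N n) ^ ((D : ℝ) * s)) atTop
      (nhds (1 / Real.sqrt (2 * s - 1) * C ^ s)) := by
  have hl := tendsto_log_div_log_of_asymp hC hm h (hN.mono fun n hn => by linarith)
  have h1 := (h.rpow_const (p := s - 1 / 2) (Or.inl hC.ne')).mul hA.sqrt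
  have h2 := h1.div (hl.rpow_const (p := (D : ℝ) * s) (Or.inl one_ne_zero)) (by simp)
  have hs1 : 0 < 2 * s - 1 := by linarith
  have e : C ^ (s - 1 / 2) * Real.sqrt (C / (2 * s - 1)) / 1 ^ ((D : ℝ) * s) =
      1 / Real.sqrt (2 * s - 1) * C ^ s := by
    rw [Real.one_rpow, div_one, Real.sqrt_div hC.le, Real.rpow_sub hC, ← Real.sqrt_eq_rpow]
    have : Real.sqrt C ≠ 0 := by positivity
    have : Real.sqrt (2 * s - 1) ≠ 0 := by positivity
    field_simp
  rw [e] at h2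
  refine h2.congr' ?_
  filter_upwards [hN, hm.eventually_gt_atTop 1] with n hn hmn
  have hl := Real.log_pos hmn
  have hlN := Real.log_pos hn
  have hm0 : 0 < m n := by linarith
  have hN0 : 0 < N n := by linarith
  simp only [Pi.div_apply]
  set L := Real.log (m n)
  set M := Real.log (N n)
  have e1 : Real.sqrt (m n ^ (1 - 2 * s) * L ^ D) = m n ^ (1 / 2 - s) * L ^ ((D : ℝ) / 2) := by
    rw [Real.sqrt_eq_rpow, Real.mul_rpow (by positivity) (by positivity), ← Real.rpow_mul hm0.le,
      ← Real.rpow_natCast, ← Real.rpow_mul hl.le]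
    congr 2 <;> ring
  have e2 : L ^ ((D : ℝ) * s) = L ^ ((D : ℝ) * (s - 1 / 2)) * L ^ ((D : ℝ) / 2) := by
    rw [← Real.rpow_add hl]; congr 1; ring
  have e3 : (L ^ D) ^ (s - 1 / 2) = L ^ ((D : ℝ) * (s - 1 / 2)) := by
    rw [← Real.rpow_natCast, ← Real.rpow_mul hl.le]
  have e4 : m n ^ (1 / 2 - s) = (m n ^ (s - 1 / 2))⁻¹ := by
    rw [← Real.rpow_neg hm0.le]; congr 1; ring
  rw [Real.sqrt_div (by positivity), Real.sqrt_sq (hA0 n), e1,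
    Real.div_rpow hN0.le (by positivity), Real.mul_rpow hm0.le (by positivity), e3,
    Real.div_rpow hlN.le hl.le, e2, e4]
  have : L ^ ((D : ℝ) * (s - 1 / 2)) ≠ 0 := by positivity
  have : L ^ ((D : ℝ) / 2) ≠ 0 := by positivity
  have : m n ^ (s - 1 / 2) ≠ 0 := by positivity
  have : M ^ ((D : ℝ) * s) ≠ 0 := by positivity
  field_simp

lemma tendsto_crossCard_atTop {r : ℝ} (hr : 0 < r) (D : ℕ) :
    Tendsto (crossCard r (D + 1)) atTop atTop := by
  have hc : (0 : ℝ) < 2 ^ (D + 1) / (Nat.factorial D : ℝ) := by positivity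
  have h1 : Tendsto (fun x : ℝ => 2 ^ (D + 1) / (Nat.factorial D : ℝ) / 2 * x) atTop atTop :=
    tendsto_id.const_mul_atTop (by positivity)
  refine tendsto_atTop_mono' atTop ?_ h1
  filter_upwards [(tendsto_crossCard hr D).eventually_const_lt (half_lt_self hc),
    eventually_ge_atTop (Real.exp 1)] with x h2 hx
  have hx0 : 0 < x := (Real.exp_pos 1).trans_le hx
  have hlx : 1 ≤ Real.log x := (Real.le_log_iff_exp_le hx0).2 hx
  rw [lt_div_iff₀ (by positivity)] at h2
  refine le_trans ?_ h2.le
  gcongr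
  exact le_mul_of_one_le_right hx0.le (one_le_pow₀ hlx)

/-- The two-sided estimate by tails of hyperbolic crosses determines the asymptotics. -/
theorem tendsto_of_crossTail_bounds {r s : ℝ} (hr : 0 < r) (hs : 1 / 2 < s) (D : ℕ)
    (hsum : Summable fun k : ZLat (D + 1) => mixNorm r k ^ (-(2 * s)))
    {A : ℕ → ℝ} (hA0 : ∀ n, 0 ≤ A n)
    (hup : ∀ n x, (hypCross r (D + 1) x).card < n → A n ^ 2 ≤ crossTail r s (D + 1) x)
    (hlo : ∀ n x, 0 < n → n ≤ (hypCross r (D + 1) x).card + 1 →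
      crossTail r s (D + 1) x ≤ A n ^ 2) :
    Tendsto (fun n : ℕ => (n : ℝ) ^ (s - 1 / 2) * A n / Real.log n ^ ((D : ℝ) * s)) atTop
      (nhds (1 / Real.sqrt (2 * s - 1) * (2 ^ (D + 1) / (Nat.factorial D : ℝ)) ^ s)) := by
  set C : ℝ := 2 ^ (D + 1) / (Nat.factorial D : ℝ) with hC
  have hex : ∀ n : ℕ, ∃ m : ℕ, n ≤ (hypCross r (D + 1) (m : ℝ)).card + 1 := by
    intro n
    have := (tendsto_crossCard_atTop hr D).comp tendsto_natCast_atTop_atTop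
    obtain ⟨m, hm⟩ := (this.eventually_ge_atTop (n : ℝ)).exists
    refine ⟨m, ?_⟩
    have h : n ≤ (hypCross r (D + 1) (m : ℝ)).card := by
      simpa only [Function.comp, crossCard, Nat.cast_le] using hm
    omega
  choose m hm hmin using fun n => (⟨Nat.find (hex n), Nat.find_spec (hex n),
    fun k hk => Nat.find_min (hex n) hk⟩ : ∃ m : ℕ, n ≤ (hypCross r (D + 1) (m : ℝ)).card + 1 ∧
      ∀ k < m, ¬ n ≤ (hypCross r (D + 1) (k : ℝ)).card + 1)
  have hmt : Tendsto m atTop atTop := by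
    refine tendsto_atTop.2 fun b => ?_
    filter_upwards [eventually_gt_atTop ((hypCross r (D + 1) (b : ℝ)).card + 1)] with n hn
    by_contra! hlt
    have := Finset.card_le_card (hypCross_mono hr (D + 1) (Nat.cast_le (α := ℝ).2 hlt.le))
    have := hm n
    omega
  have hmr : Tendsto (fun n => (m n : ℝ)) atTop atTop := tendsto_natCast_atTop_atTop.comp hmt
  have hpred : ∀ᶠ n in atTop, (hypCross r (D + 1) ((m n : ℝ) - 1)).card + 1 < n := by
    filter_upwards [hmt.eventually_gt_atTop 0] with n hn
    have := hmin n (m n - 1) (by omega)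
    rw [Nat.cast_sub (by omega)] at this
    push Not at this
    exact_mod_cast this
  have hcard : Tendsto (fun x => crossCard r (D + 1) x / (x ^ (1 : ℝ) * Real.log x ^ D)) atTop
      (nhds C) := by
    simp_rw [Real.rpow_one]
    exact tendsto_crossCard hr D
  have hcard' := tendsto_comp_sub_one hcard
  simp_rw [Real.rpow_one] at hcard hcard'
  have htail := tendsto_crossTail hr hs D hsum
  have htail' := tendsto_comp_sub_one htail
  have hφ : ∀ᶠ n in atTop, 0 < (m n : ℝ) * Real.log (m n) ^ D ∧
      0 < (m n : ℝ) ^ (1 - 2 * s) * Real.log (m n) ^ D := by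
    filter_upwards [hmr.eventually_gt_atTop 1] with n hn
    have := Real.log_pos hn
    constructor <;> positivity
  refine tendsto_of_asymp (m := fun n => (m n : ℝ)) (by positivity) hs hmr ?_ ?_ hA0 ?_
  · have hone : Tendsto (fun x : ℝ => 1 / (x * Real.log x ^ D)) atTop (nhds 0) := by
      refine squeeze_zero' ?_ ?_ tendsto_inv_atTop_zero
      · filter_upwards [eventually_gt_atTop 1] with x hx
        have := Real.log_pos hx
        positivity
      · filter_upwards [eventually_ge_atTop (Real.exp 1)] with x hx
        have hx0 : 0 < x := (Real.exp_pos 1).trans_le hx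
        have hlx : 1 ≤ Real.log x := (Real.le_log_iff_exp_le hx0).2 hx
        rw [one_div]
        gcongr
        exact le_mul_of_one_le_right hx0.le (one_le_pow₀ hlx)
    have hupper := hcard.add hone
    rw [add_zero] at hupper
    refine tendsto_of_tendsto_of_tendsto_of_le_of_le' (hcard'.comp hmr) (hupper.comp hmr) ?_ ?_
    · filter_upwards [hpred, hφ] with n hn h
      have := h.1
      have h3 : crossCard r (D + 1) ((m n : ℝ) - 1) ≤ n := by
        unfold crossCard
        exact Nat.cast_le.2 (by omega)
      simp only [Function.comp]
      gcongr
    · filter_upwards [hφ] with n h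
      have := h.1
      have h3 : (n : ℝ) ≤ crossCard r (D + 1) (m n) + 1 := by
        unfold crossCard
        exact_mod_cast hm n
      simp only [Function.comp]
      rw [← add_div]
      gcongr
  · filter_upwards [eventually_gt_atTop 1] with n hn
    exact_mod_cast hn
  · refine tendsto_of_tendsto_of_tendsto_of_le_of_le' (htail.comp hmr) (htail'.comp hmr) ?_ ?_
    · filter_upwards [hφ, eventually_gt_atTop 0] with n h hn
      have := h.2
      have h3 := hlo n _ hn (hm n)
      simp only [Function.comp]
      gcongr
    · filter_upwards [hpred, hφ] with n hn h
      have := h.2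
      have h3 := hup n ((m n : ℝ) - 1) (by omega)
      simp only [Function.comp]
      gcongr

theorem torusMeasure_eq_pi_haar (d : ℕ) :
    torusMeasure d = Measure.pi fun _ : Fin d => (AddCircle.haarAddCircle (T := 2 * Real.pi)) := by
  symm
  refine Measure.pi_eq fun s _ => ?_
  have h0 : ENNReal.ofReal (2 * Real.pi) ≠ 0 := by
    simp [Real.pi_pos]
  have hm : ∀ t : Set (AddCircle (2 * Real.pi)),
      AddCircle.haarAddCircle t = (ENNReal.ofReal (2 * Real.pi))⁻¹ * volume t := by
    intro t
    rw [AddCircle.volume_eq_smul_haarAddCircle, Measure.smul_apply, smul_eq_mul, ← mul_assoc,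
      ENNReal.inv_mul_cancel h0 ENNReal.ofReal_ne_top, one_mul]
  rw [torusMeasure, Measure.smul_apply, Measure.pi_pi, smul_eq_mul]
  simp only [hm, Finset.prod_mul_distrib, Finset.prod_const, Finset.card_univ, Fintype.card_fin]

instance torusMeasure_isProbabilityMeasure (d : ℕ) : IsProbabilityMeasure (torusMeasure d) := by
  rw [torusMeasure_eq_pi_haar]
  infer_instance

/-- The character `torusChar k` as a continuous function. -/
def torusCharC {d : ℕ} (k : ZLat d) : C(Torus d, ℂ) where
  toFun := torusChar k
  continuous_toFun := by unfold torusChar; fun_prop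

theorem torusCharC_apply {d : ℕ} (k : ZLat d) (x : Torus d) :
    torusCharC k x = ∏ j, fourier (k j) (x j) := rfl

theorem torusCharC_neg {d : ℕ} (k : ZLat d) (x : Torus d) :
    torusCharC (-k) x = (starRingEnd ℂ) (torusCharC k x) := by
  simp only [torusCharC_apply, Pi.neg_apply, fourier_neg, map_prod]

theorem torusCharC_add {d : ℕ} (k l : ZLat d) :
    torusCharC (k + l) = torusCharC k * torusCharC l := by
  ext x
  simp only [torusCharC_apply, Pi.add_apply, fourier_add, ContinuousMap.mul_apply,
    ← Finset.prod_mul_distrib]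

theorem torusCharC_zero {d : ℕ} : torusCharC (0 : ZLat d) = 1 := by
  ext x
  simp only [torusCharC_apply, Pi.zero_apply, fourier_zero, Finset.prod_const_one,
    ContinuousMap.one_apply]

theorem torusCharC_single {d : ℕ} (x : Torus d) (i : Fin d) :
    torusCharC (Pi.single i 1) x = fourier 1 (x i) := by
  rw [torusCharC_apply, Finset.prod_eq_single i]
  · rw [Pi.single_eq_same]
  · intro j _ hj
    rw [Pi.single_eq_of_ne hj, fourier_zero]
  · simp

theorem norm_torusChar {d : ℕ} (k : ZLat d) (x : Torus d) : ‖torusChar k x‖ = 1 := by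
  simp only [torusChar, norm_prod, fourier_apply, Circle.norm_coe, Finset.prod_const_one]

/-- The star subalgebra of `C(Torus d, ℂ)` generated by the characters. -/
def torusCharSubalgebra (d : ℕ) : StarSubalgebra ℂ C(Torus d, ℂ) where
  toSubalgebra := Algebra.adjoin ℂ (Set.range torusCharC)
  star_mem' := by
    change Algebra.adjoin ℂ (Set.range torusCharC) ≤
      star (Algebra.adjoin ℂ (Set.range torusCharC))
    refine Algebra.adjoin_le ?_
    rintro _ ⟨k, rfl⟩
    refine Algebra.subset_adjoin ⟨-k, ?_⟩
    ext1 x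
    simp only [torusCharC_neg, starRingEnd_apply, ContinuousMap.star_apply]

theorem torusCharSubalgebra_coe (d : ℕ) :
    Subalgebra.toSubmodule (torusCharSubalgebra d).toSubalgebra =
      Submodule.span ℂ (Set.range torusCharC) := by
  apply Algebra.adjoin_eq_span_of_subset
  refine .trans (fun x ↦ Submonoid.closure_induction (fun _ ↦ id) ⟨0, torusCharC_zero⟩ ?_)
    Submodule.subset_span
  rintro _ _ _ _ ⟨m, rfl⟩ ⟨n, rfl⟩
  exact ⟨m + n, torusCharC_add m n⟩

theorem torusCharSubalgebra_separatesPoints (d : ℕ) :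
    (torusCharSubalgebra d).SeparatesPoints := by
  intro x y hxy
  rw [Ne, funext_iff, not_forall] at hxy
  obtain ⟨i, hi⟩ := hxy
  refine ⟨_, ⟨torusCharC (Pi.single i 1), Algebra.subset_adjoin ⟨Pi.single i 1, rfl⟩, rfl⟩, ?_⟩
  intro h
  have h2 : torusCharC (Pi.single i 1) x = torusCharC (Pi.single i 1) y := h
  rw [torusCharC_single, torusCharC_single, fourier_one, fourier_one] at h2
  exact hi (AddCircle.injective_toCircle (by positivity) (Circle.ext h2))

theorem span_torusCharC_closure_eq_top (d : ℕ) :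
    (Submodule.span ℂ (Set.range (torusCharC (d := d)))).topologicalClosure = ⊤ := by
  rw [← torusCharSubalgebra_coe]
  exact congr_arg (Subalgebra.toSubmodule <| StarSubalgebra.toSubalgebra ·)
    (ContinuousMap.starSubalgebra_topologicalClosure_eq_top_of_separatesPoints _
      (torusCharSubalgebra_separatesPoints d))

/-- The character `torusChar k` as an element of `L²`. -/
def torusCharL2 {d : ℕ} (k : ZLat d) : Lp ℂ 2 (torusMeasure d) :=
  ContinuousMap.toLp (E := ℂ) 2 (torusMeasure d) ℂ (torusCharC k)

theorem coeFn_torusCharL2 {d : ℕ} (k : ZLat d) :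
    torusCharL2 k =ᵐ[torusMeasure d] torusChar k :=
  ContinuousMap.coeFn_toLp (torusMeasure d) (torusCharC k)

theorem span_torusCharL2_closure_eq_top (d : ℕ) :
    (Submodule.span ℂ (Set.range (torusCharL2 (d := d)))).topologicalClosure = ⊤ := by
  have : (torusMeasure d).WeaklyRegular := by
    rw [torusMeasure_eq_pi_haar]; infer_instance
  have h := (ContinuousMap.toLp_denseRange ℂ (torusMeasure d) ℂ
    (p := 2) (by simp)).topologicalClosure_map_submodule (span_torusCharC_closure_eq_top d)
  rw [Submodule.map_span, ← Set.range_comp] at h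
  exact h

theorem inner_torusCharL2 {d : ℕ} (k : ZLat d) (f : Lp ℂ 2 (torusMeasure d)) :
    inner ℂ (torusCharL2 k) f = fourierCoef f k := by
  rw [L2.inner_def, fourierCoef]
  refine integral_congr_ae ?_
  filter_upwards [coeFn_torusCharL2 k] with x hx
  rw [hx, RCLike.inner_apply, mul_comm]

theorem orthonormal_torusCharL2 (d : ℕ) : Orthonormal ℂ (torusCharL2 (d := d)) := by
  rw [orthonormal_iff_ite]
  intro m n
  rw [torusCharL2, torusCharL2, ContinuousMap.inner_toLp]
  simp only [← torusCharC_neg, ← ContinuousMap.mul_apply, ← torusCharC_add]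
  split_ifs with h
  · simp [h, torusCharC_zero]
  · simp only [torusCharC_apply]
    rw [torusMeasure_eq_pi_haar, integral_fintype_prod_eq_prod
      (f := fun (i : Fin d) (y : AddCircle (2 * Real.pi)) => (fourier ((n + -m) i) y : ℂ))]
    obtain ⟨i, hi⟩ := Function.ne_iff.mp h
    apply Finset.prod_eq_zero (Finset.mem_univ i)
    simpa only [eq_false_intro hi, if_false, ContinuousMap.inner_toLp, ← fourier_neg,
      ← fourier_add] using! (orthonormal_iff_ite.mp <| orthonormal_fourier) (m i) (n i)

/-- An element of `L²` is determined by its Fourier coefficients. -/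
theorem eq_of_fourierCoef_eq {d : ℕ} {f g : Lp ℂ 2 (torusMeasure d)}
    (h : ∀ k, fourierCoef f k = fourierCoef g k) : f = g := by
  refine (Submodule.dense_iff_topologicalClosure_eq_top.2
    (span_torusCharL2_closure_eq_top d)).eq_of_inner_right ℂ fun v hv => ?_
  rw [SetLike.mem_coe] at hv
  induction hv using Submodule.span_induction with
  | mem x hx =>
    obtain ⟨k, rfl⟩ := hx
    rw [inner_torusCharL2, inner_torusCharL2, h]
  | zero => simp
  | add x y _ _ hx hy => rw [inner_add_left, inner_add_left, hx, hy]
  | smul a x _ hx => rw [inner_smul_left, inner_smul_left, hx]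

section SquareSum

variable {Ω : Type*} [MeasurableSpace Ω] {μ : Measure Ω}

theorem ae_norm_le_norm_of_Lp_top (f : Lp ℂ ⊤ μ) : ∀ᵐ x ∂μ, ‖f x‖ ≤ ‖f‖ := by
  have h1 : ∀ᵐ x ∂μ, ‖f x‖ₑ ≤ eLpNormEssSup f μ := ae_le_eLpNormEssSup
  filter_upwards [h1] with x hx
  rw [Lp.norm_def, eLpNorm_exponent_top, ← toReal_enorm]
  refine ENNReal.toReal_mono ?_ hx
  rw [← eLpNorm_exponent_top]
  exact Lp.eLpNorm_ne_top f

theorem integrable_norm_sq_of_Lp_two (f : Lp ℂ 2 μ) : Integrable (fun x => ‖f x‖ ^ 2) μ :=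
  (memLp_two_iff_integrable_sq_norm (Lp.aestronglyMeasurable f)).1 (Lp.memLp f)

theorem norm_sq_eq_integral_of_Lp_two (f : Lp ℂ 2 μ) : ‖f‖ ^ 2 = ∫ x, ‖f x‖ ^ 2 ∂μ := by
  have h := L2.inner_def (𝕜 := ℂ) f f
  simp only [inner_self_eq_norm_sq_to_K] at h
  have h2 : ((‖f‖ ^ 2 : ℝ) : ℂ) = ((∫ x, ‖f x‖ ^ 2 ∂μ : ℝ) : ℂ) := by
    rw [← integral_complex_ofReal]
    push_cast
    exact h
  exact_mod_cast h2

theorem ae_sum_sq_le_of_norm_sum_le {ι : Type*} [Fintype ι] (f : ι → Lp ℂ ⊤ μ) {M : ℝ}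
    (h : ∀ c : EuclideanSpace ℂ ι, ‖∑ k, c k • f k‖ ≤ M * ‖c‖) :
    ∀ᵐ x ∂μ, ∑ k, ‖f k x‖ ^ 2 ≤ M ^ 2 := by
  have hdense : ∀ᵐ x ∂μ, ∀ n : ℕ,
      ‖∑ k, TopologicalSpace.denseSeq (EuclideanSpace ℂ ι) n k * f k x‖ ≤
        M * ‖TopologicalSpace.denseSeq (EuclideanSpace ℂ ι) n‖ := by
    rw [ae_all_iff]
    intro n
    set c := TopologicalSpace.denseSeq (EuclideanSpace ℂ ι) n
    have h2 : ∀ᵐ x ∂μ, ∀ k, (c k • f k : Lp ℂ ⊤ μ) x = c k * f k x := by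
      rw [ae_all_iff]
      intro k
      filter_upwards [Lp.coeFn_smul (c k) (f k)] with x hx
      rw [hx, Pi.smul_apply, smul_eq_mul]
    filter_upwards [ae_norm_le_norm_of_Lp_top (∑ k, c k • f k),
      Lp.coeFn_finsetSum Finset.univ (fun k => c k • f k), h2] with x h1 h3 h2
    rw [h3, Finset.sum_apply] at h1
    simp only [h2] at h1
    exact h1.trans (h c)
  filter_upwards [hdense] with x hx
  have hall : ∀ c : EuclideanSpace ℂ ι, ‖∑ k, c k * f k x‖ ≤ M * ‖c‖ := by
    intro c
    have hcl : IsClosed {c : EuclideanSpace ℂ ι | ‖∑ k, c k * f k x‖ ≤ M * ‖c‖} :=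
      isClosed_le (by fun_prop) (by fun_prop)
    have := (TopologicalSpace.denseRange_denseSeq (EuclideanSpace ℂ ι)).closure_range
    have hsub := hcl.closure_subset_iff.2 (Set.range_subset_iff.2 hx)
    rw [this] at hsub
    exact hsub (Set.mem_univ c)
  have h3 := hall (WithLp.toLp 2 fun k => (starRingEnd ℂ) (f k x))
  set N := ∑ k, ‖f k x‖ ^ 2 with hN
  have hN0 : 0 ≤ N := Finset.sum_nonneg fun _ _ => sq_nonneg _
  have e1 : ∑ k, (starRingEnd ℂ) (f k x) * f k x = (N : ℂ) := by
    rw [hN]; push_cast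
    exact Finset.sum_congr rfl fun k _ => by rw [Complex.conj_mul']
  have e2 : ‖(WithLp.toLp 2 fun k => (starRingEnd ℂ) (f k x) : EuclideanSpace ℂ ι)‖ =
      Real.sqrt N := by
    rw [EuclideanSpace.norm_eq]
    simp [hN]
  rw [e2] at h3
  simp only [e1] at h3
  rw [Complex.norm_real, Real.norm_of_nonneg (r := N) hN0] at h3
  rcases hN0.eq_or_lt with h0 | h0
  · rw [← h0]; positivity
  · have hs := Real.sqrt_pos.2 h0
    have : Real.sqrt N ≤ M := by
      rw [← Real.mul_self_sqrt hN0] at h3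
      nlinarith [Real.mul_self_sqrt hN0, Real.sqrt_mul_self hs.le]
    rw [← Real.sq_sqrt hN0]
    gcongr

variable [IsProbabilityMeasure μ]

/-- The inclusion of `L∞` into `L²` for a probability measure. -/
def linftyToL2 : Lp ℂ ⊤ μ →ₗ[ℂ] Lp ℂ 2 μ where
  toFun f := ((Lp.memLp f).mono_exponent le_top).toLp f
  map_add' f g := by
    rw [← MemLp.toLp_add]
    exact MemLp.toLp_congr _ _ (Lp.coeFn_add f g)
  map_smul' c f := by
    rw [RingHom.id_apply, ← MemLp.toLp_const_smul]
    exact MemLp.toLp_congr _ _ (Lp.coeFn_smul c f)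

theorem coeFn_linftyToL2 (f : Lp ℂ ⊤ μ) : linftyToL2 f =ᵐ[μ] f :=
  MemLp.coeFn_toLp ((Lp.memLp f).mono_exponent le_top)

theorem sum_norm_sq_linftyToL2_le {ι : Type*} [Fintype ι] (f : ι → Lp ℂ ⊤ μ) {M : ℝ}
    (h : ∀ c : EuclideanSpace ℂ ι, ‖∑ k, c k • f k‖ ≤ M * ‖c‖) :
    ∑ k, ‖linftyToL2 (f k)‖ ^ 2 ≤ M ^ 2 := by
  simp only [norm_sq_eq_integral_of_Lp_two]
  rw [← integral_finsetSum _ fun k _ => integrable_norm_sq_of_Lp_two _]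
  have hle : ∀ᵐ x ∂μ, ∑ k, ‖linftyToL2 (f k) x‖ ^ 2 ≤ M ^ 2 := by
    have h2 : ∀ᵐ x ∂μ, ∀ k, linftyToL2 (f k) x = f k x :=
      ae_all_iff.2 fun k => coeFn_linftyToL2 (f k)
    filter_upwards [h2, ae_sum_sq_le_of_norm_sum_le f h] with x hx h3
    simpa only [hx] using h3
  calc _ ≤ ∫ _ : Ω, M ^ 2 ∂μ := integral_mono_ae
        (integrable_finsetSum _ fun k _ => integrable_norm_sq_of_Lp_two _)
        (integrable_const _) hle
    _ = M ^ 2 := by simp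

end SquareSum

theorem norm_sub_sq_ge_of_mem {E : Type*} [NormedAddCommGroup E] [InnerProductSpace ℂ E]
    (V : Submodule ℂ E) [V.HasOrthogonalProjection] (y : E) {v : E} (hv : v ∈ V) :
    ‖y‖ ^ 2 - ‖V.starProjection y‖ ^ 2 ≤ ‖y - v‖ ^ 2 := by
  have h1 := Submodule.norm_sq_eq_add_norm_sq_starProjection y V
  have h2 := Submodule.norm_sq_eq_add_norm_sq_starProjection (y - v) V
  have h3 : Vᗮ.starProjection v = 0 := Submodule.starProjection_orthogonal_apply_eq_zero hv
  rw [map_sub Vᗮ.starProjection, h3, sub_zero] at h2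
  nlinarith [sq_nonneg ‖V.starProjection (y - v)‖]

theorem sum_norm_sq_starProjection_le {E ι : Type*} [NormedAddCommGroup E]
    [InnerProductSpace ℂ E] (V : Submodule ℂ E) [FiniteDimensional ℂ V] {e : ι → E}
    (he : Orthonormal ℂ e) (F : Finset ι) :
    ∑ k ∈ F, ‖V.starProjection (e k)‖ ^ 2 ≤ Module.finrank ℂ V := by
  have h1 : ∀ k, ‖V.starProjection (e k)‖ ^ 2 =
      ∑ i, ‖inner ℂ (stdOrthonormalBasis ℂ V i : E) (e k)‖ ^ 2 := by
    intro k
    rw [Submodule.starProjection_apply, ← Submodule.coe_norm,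
      ← (stdOrthonormalBasis ℂ V).sum_sq_norm_inner_right]
    simp only [Submodule.inner_orthogonalProjectionOnto_eq_of_mem_left]
  simp only [h1]
  rw [Finset.sum_comm]
  calc _ ≤ ∑ i : Fin (Module.finrank ℂ V), (1 : ℝ) := by
        refine Finset.sum_le_sum fun i _ => ?_
        have h2 := he.sum_inner_products_le (stdOrthonormalBasis ℂ V i : E) (s := F)
        have h3 : ‖(stdOrthonormalBasis ℂ V i : E)‖ = 1 :=
          (stdOrthonormalBasis ℂ V).orthonormal.1 i
        rw [h3, one_pow] at h2
        simpa only [norm_inner_symm] using h2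
    _ = Module.finrank ℂ V := by simp

theorem sum_sdiff_le_sum_mul_one_sub {ι : Type*} [DecidableEq ι] {H F : Finset ι} (hHF : H ⊆ F)
    {a p : ι → ℝ} {ρ : ℝ} (hρ : 0 ≤ ρ) (hH : ∀ k ∈ H, ρ ≤ a k) (hF : ∀ k ∈ F \ H, a k ≤ ρ)
    (hp0 : ∀ k, 0 ≤ p k) (hp1 : ∀ k, p k ≤ 1) (hsum : ∑ k ∈ F, p k ≤ H.card) :
    ∑ k ∈ F \ H, a k ≤ ∑ k ∈ F, a k * (1 - p k) := by
  have h1 : ∑ k ∈ H, ρ * (1 - p k) ≤ ∑ k ∈ H, a k * (1 - p k) :=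
    Finset.sum_le_sum fun k hk =>
      mul_le_mul_of_nonneg_right (hH k hk) (sub_nonneg.2 (hp1 k))
  have h2 : ∑ k ∈ F \ H, a k * p k ≤ ∑ k ∈ F \ H, ρ * p k :=
    Finset.sum_le_sum fun k hk => mul_le_mul_of_nonneg_right (hF k hk) (hp0 k)
  rw [← Finset.sum_sdiff hHF] at hsum ⊢
  simp only [mul_sub, mul_one, Finset.sum_sub_distrib, ← Finset.mul_sum, Finset.sum_const,
    nsmul_eq_mul] at *
  nlinarith

/-- The `k`-th unit vector of `ℓ²(ℤ^d)`. -/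
def ellTwoUnit {d : ℕ} (k : ZLat d) : ellTwo d := lp.single 2 k 1

theorem smul_ellTwoUnit {d : ℕ} (k : ZLat d) (c : ℂ) :
    c • ellTwoUnit k = (lp.single 2 k c : ellTwo d) := by
  rw [ellTwoUnit, ← lp.single_smul, smul_eq_mul, mul_one]

theorem sum_norm_sq_apply_ellTwoUnit_le {d : ℕ} (B : ellTwo d →L[ℂ] Lp ℂ ⊤ (torusMeasure d))
    (F : Finset (ZLat d)) :
    ∑ k ∈ F, ‖linftyToL2 (B (ellTwoUnit k))‖ ^ 2 ≤ ‖B‖ ^ 2 := by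
  rw [← Finset.sum_coe_sort]
  refine sum_norm_sq_linftyToL2_le (fun k : F => B (ellTwoUnit k.1)) fun c => ?_
  have h1 : ∑ k : F, c k • B (ellTwoUnit k.1) = B (∑ k : F, c k • ellTwoUnit k.1) := by
    simp only [map_sum, map_smul]
  rw [h1]
  refine (B.le_opNorm _).trans (mul_le_mul_of_nonneg_left (le_of_eq ?_) (norm_nonneg _))
  let g : ZLat d → ℂ := fun k => if h : k ∈ F then c ⟨k, h⟩ else 0
  have hg : ∀ k : F, c k = g k.1 := fun k => by simp [g]
  have h2 := lp.norm_sum_single (E := fun _ : ZLat d => ℂ) (p := 2) (by simp) g F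
  simp only [ENNReal.toReal_ofNat, Real.rpow_ofNat] at h2
  rw [EuclideanSpace.norm_eq]
  simp only [hg, smul_ellTwoUnit]
  rw [Finset.sum_coe_sort F fun k => (lp.single 2 k (g k) : ellTwo d),
    Finset.sum_coe_sort F fun k => ‖g k‖ ^ 2, ← h2, Real.sqrt_sq (norm_nonneg _)]

section Embedding

variable {d : ℕ} {w : ZLat d → ℝ} {T : ellTwo d →L[ℂ] Lp ℂ ⊤ (torusMeasure d)}

theorem linftyToL2_apply_ellTwoUnit
    (hT : ∀ (c : ellTwo d) (k : ZLat d), fourierCoef (⇑(T c)) k = c k / (w k : ℂ))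
    (k : ZLat d) : linftyToL2 (T (ellTwoUnit k)) = ((w k)⁻¹ : ℂ) • torusCharL2 k := by
  refine eq_of_fourierCoef_eq fun l => ?_
  have h1 : fourierCoef (linftyToL2 (T (ellTwoUnit k))) l = fourierCoef (T (ellTwoUnit k)) l := by
    refine integral_congr_ae ?_
    filter_upwards [coeFn_linftyToL2 (T (ellTwoUnit k))] with x hx
    rw [hx]
  rw [h1, hT, ← inner_torusCharL2, inner_smul_right,
    orthonormal_iff_ite.1 (orthonormal_torusCharL2 d) l k, ellTwoUnit, lp.single_apply]
  by_cases h : l = k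
  · subst h; simp
  · simp [h]

theorem norm_linftyToL2_apply_ellTwoUnit
    (hT : ∀ (c : ellTwo d) (k : ZLat d), fourierCoef (⇑(T c)) k = c k / (w k : ℂ))
    (hw : ∀ k, 0 < w k) (k : ZLat d) : ‖linftyToL2 (T (ellTwoUnit k))‖ = (w k)⁻¹ := by
  rw [linftyToL2_apply_ellTwoUnit hT, norm_smul, (orthonormal_torusCharL2 d).1, mul_one,
    norm_inv, Complex.norm_real, Real.norm_of_nonneg (r := w k) (hw k).le]

theorem norm_apply_ellTwoUnit_le
    (hT : ∀ (c : ellTwo d) (k : ZLat d), fourierCoef (⇑(T c)) k = c k / (w k : ℂ))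
    (hw : ∀ k, 0 < w k) (k : ZLat d) : ‖T (ellTwoUnit k)‖ ≤ (w k)⁻¹ := by
  have hC : (0 : ℝ) ≤ (w k)⁻¹ := (inv_pos.2 (hw k)).le
  have hae : ∀ᵐ x ∂(torusMeasure d), ‖T (ellTwoUnit k) x‖ ≤ (w k)⁻¹ := by
    have h1 := linftyToL2_apply_ellTwoUnit hT k
    filter_upwards [coeFn_linftyToL2 (T (ellTwoUnit k)), coeFn_torusCharL2 k,
      Lp.coeFn_smul ((w k)⁻¹ : ℂ) (torusCharL2 k)] with x h2 h3 h4
    rw [← h2, h1, h4, Pi.smul_apply, h3, norm_smul, norm_torusChar, mul_one, norm_inv,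
      Complex.norm_real, Real.norm_of_nonneg (r := w k) (hw k).le]
  rw [Lp.norm_def, eLpNorm_exponent_top]
  refine ENNReal.toReal_le_of_le_ofReal hC ?_
  exact eLpNormEssSup_le_of_ae_bound hae

theorem summable_inv_sq_of_embedding
    (hT : ∀ (c : ellTwo d) (k : ZLat d), fourierCoef (⇑(T c)) k = c k / (w k : ℂ))
    (hw : ∀ k, 0 < w k) : Summable fun k => (w k)⁻¹ ^ 2 := by
  refine summable_of_sum_le (c := ‖T‖ ^ 2) (fun k => sq_nonneg _) fun F => ?_
  simpa only [norm_linftyToL2_apply_ellTwoUnit hT hw] using sum_norm_sq_apply_ellTwoUnit_le T F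

/-- Lower bound for the distance of `T` to an operator of small rank, through the squared
Hilbert–Schmidt norm of the tail. -/
theorem tsum_tail_le_norm_sub_sq
    (hT : ∀ (c : ellTwo d) (k : ZLat d), fourierCoef (⇑(T c)) k = c k / (w k : ℂ))
    (hw : ∀ k, 0 < w k) {A : ellTwo d →L[ℂ] Lp ℂ ⊤ (torusMeasure d)} {n : ℕ}
    (hA : Module.rank ℂ (LinearMap.range (A : ellTwo d →ₗ[ℂ] Lp ℂ ⊤ (torusMeasure d))) < n)
    {H : Finset (ZLat d)} (hn : n ≤ H.card + 1) {ρ : ℝ} (hρ : 0 ≤ ρ)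
    (hH : ∀ k ∈ H, ρ ≤ (w k)⁻¹ ^ 2) (hH' : ∀ k ∉ H, (w k)⁻¹ ^ 2 ≤ ρ) :
    ∑' k, (if k ∈ H then 0 else (w k)⁻¹ ^ 2) ≤ ‖T - A‖ ^ 2 := by
  set V : Submodule ℂ (Lp ℂ 2 (torusMeasure d)) :=
    (LinearMap.range (A : ellTwo d →ₗ[ℂ] Lp ℂ ⊤ (torusMeasure d))).map linftyToL2 with hV
  have hrank : Module.rank ℂ V < n := (rank_map_le _ _).trans_lt hA
  have : FiniteDimensional ℂ V :=
    Module.rank_lt_aleph0_iff.1 (hrank.trans (Cardinal.natCast_lt_aleph0))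
  have hfin : Module.finrank ℂ V ≤ H.card := by
    have : Module.finrank ℂ V < n := by
      rw [← Module.finrank_eq_rank] at hrank
      exact_mod_cast hrank
    omega
  have hV1 : ∀ k, (w k)⁻¹ ^ 2 * (1 - ‖V.starProjection (torusCharL2 k)‖ ^ 2) ≤
      ‖linftyToL2 ((T - A) (ellTwoUnit k))‖ ^ 2 := by
    intro k
    have hmem : linftyToL2 (A (ellTwoUnit k)) ∈ V :=
      Submodule.mem_map_of_mem ⟨ellTwoUnit k, rfl⟩
    have h := norm_sub_sq_ge_of_mem V (linftyToL2 (T (ellTwoUnit k))) hmem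
    rw [← map_sub] at h
    refine le_trans (le_of_eq ?_) h
    rw [norm_linftyToL2_apply_ellTwoUnit hT hw, linftyToL2_apply_ellTwoUnit hT, map_smul,
      norm_smul, norm_inv, Complex.norm_real, Real.norm_of_nonneg (r := w k) (hw k).le]
    ring
  refine Real.tsum_le_of_sum_le (fun k => ?_) fun F => ?_
  · dsimp only
    split_ifs
    exacts [le_rfl, sq_nonneg _]
  calc ∑ k ∈ F, (if k ∈ H then 0 else (w k)⁻¹ ^ 2)
      ≤ ∑ k ∈ F ∪ H, (if k ∈ H then 0 else (w k)⁻¹ ^ 2) := by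
        refine Finset.sum_le_sum_of_subset_of_nonneg Finset.subset_union_left fun k _ _ => ?_
        split_ifs
        exacts [le_rfl, sq_nonneg _]
    _ = ∑ k ∈ (F ∪ H) \ H, (w k)⁻¹ ^ 2 := by
        rw [Finset.sdiff_eq_filter, Finset.sum_filter]
        exact Finset.sum_congr rfl fun k _ => by split_ifs <;> rfl
    _ ≤ ∑ k ∈ F ∪ H, (w k)⁻¹ ^ 2 * (1 - ‖V.starProjection (torusCharL2 k)‖ ^ 2) := by
        refine sum_sdiff_le_sum_mul_one_sub Finset.subset_union_right hρ hH
          (fun k hk => hH' k (Finset.mem_sdiff.1 hk).2) (fun k => sq_nonneg _) (fun k => ?_) ?_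
        · have h := Submodule.norm_starProjection_apply_le V (torusCharL2 k)
          rw [(orthonormal_torusCharL2 d).1] at h
          exact pow_le_one₀ (norm_nonneg _) h
        · exact (sum_norm_sq_starProjection_le V (orthonormal_torusCharL2 d) _).trans
            (Nat.cast_le.2 hfin)
    _ ≤ ∑ k ∈ F ∪ H, ‖linftyToL2 ((T - A) (ellTwoUnit k))‖ ^ 2 :=
        Finset.sum_le_sum fun k _ => hV1 k
    _ ≤ ‖T - A‖ ^ 2 := sum_norm_sq_apply_ellTwoUnit_le _ _

/-- The Fourier partial sum operator over `H` approximates `T` up to the tail. -/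
theorem exists_rank_le_norm_sub_le
    (hT : ∀ (c : ellTwo d) (k : ZLat d), fourierCoef (⇑(T c)) k = c k / (w k : ℂ))
    (hw : ∀ k, 0 < w k) (H : Finset (ZLat d)) :
    ∃ A : ellTwo d →L[ℂ] Lp ℂ ⊤ (torusMeasure d),
      Module.rank ℂ (LinearMap.range (A : ellTwo d →ₗ[ℂ] Lp ℂ ⊤ (torusMeasure d))) ≤ H.card ∧
      ‖T - A‖ ≤ Real.sqrt (∑' k, if k ∈ H then 0 else (w k)⁻¹ ^ 2) := by
  have hsum : Summable fun k => if k ∈ H then 0 else (w k)⁻¹ ^ 2 := by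
    refine (summable_inv_sq_of_embedding hT hw).of_nonneg_of_le (fun k => ?_) fun k => ?_
    all_goals split_ifs
    exacts [le_rfl, sq_nonneg _, sq_nonneg _, le_rfl]
  let A : ellTwo d →L[ℂ] Lp ℂ ⊤ (torusMeasure d) :=
    ∑ k ∈ H, (lp.evalCLM ℂ (fun _ : ZLat d => ℂ) 2 k).smulRight (T (ellTwoUnit k))
  have hA : ∀ c, A c = ∑ k ∈ H, c k • T (ellTwoUnit k) := by
    intro c
    simp only [A, sum_apply]
    rfl
  refine ⟨A, ?_, ?_⟩
  · classical
    have hle : LinearMap.range (A : ellTwo d →ₗ[ℂ] Lp ℂ ⊤ (torusMeasure d)) ≤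
        Submodule.span ℂ (H.image fun k => T (ellTwoUnit k) : Set (Lp ℂ ⊤ (torusMeasure d))) := by
      rintro _ ⟨c, rfl⟩
      change A c ∈ _
      rw [hA]
      exact Submodule.sum_mem _ fun k hk => Submodule.smul_mem _ _
        (Submodule.subset_span (Finset.mem_coe.2 (Finset.mem_image_of_mem _ hk)))
    exact (Submodule.rank_mono hle).trans ((rank_span_finset_le _).trans
      (Nat.cast_le.2 Finset.card_image_le))
  · refine ContinuousLinearMap.opNorm_le_bound _ (Real.sqrt_nonneg _) fun c => ?_
    have h1 : HasSum (fun k => c k • T (ellTwoUnit k)) (T c) := by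
      have h := T.hasSum (lp.hasSum_single (by simp) c)
      simpa only [← smul_ellTwoUnit, map_smul] using h
    have h2 : Tendsto (fun F : Finset (ZLat d) => ∑ k ∈ F, c k • T (ellTwoUnit k) - A c) atTop
        (nhds ((T - A) c)) := Tendsto.sub_const h1 (A c)
    refine le_of_tendsto h2.norm ?_
    filter_upwards [eventually_ge_atTop H] with F hF
    have h3 : ∑ k ∈ F, c k • T (ellTwoUnit k) - A c = ∑ k ∈ F \ H, c k • T (ellTwoUnit k) := by
      rw [hA, ← Finset.sum_sdiff hF, add_sub_cancel_right]
    rw [h3]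
    calc ‖∑ k ∈ F \ H, c k • T (ellTwoUnit k)‖
        ≤ ∑ k ∈ F \ H, (w k)⁻¹ * ‖c k‖ := by
          refine norm_sum_le_of_le _ fun k _ => ?_
          rw [norm_smul, mul_comm]
          exact mul_le_mul_of_nonneg_right (norm_apply_ellTwoUnit_le hT hw k) (norm_nonneg _)
      _ ≤ Real.sqrt (∑ k ∈ F \ H, (w k)⁻¹ ^ 2) * Real.sqrt (∑ k ∈ F \ H, ‖c k‖ ^ 2) :=
          Real.sum_mul_le_sqrt_mul_sqrt _ _ _
      _ ≤ _ := by
          refine mul_le_mul (Real.sqrt_le_sqrt ?_) ?_ (Real.sqrt_nonneg _) (Real.sqrt_nonneg _)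
          · refine le_trans (le_of_eq (Finset.sum_congr rfl fun k hk => ?_))
              (hsum.sum_le_tsum (F \ H) fun k _ => ?_)
            · rw [if_neg (Finset.mem_sdiff.1 hk).2]
            · split_ifs
              exacts [le_rfl, sq_nonneg _]
          · refine Real.sqrt_le_iff.2 ⟨norm_nonneg _, ?_⟩
            have h := lp.sum_rpow_le_norm_rpow (p := 2) (by simp) c (F \ H)
            simpa only [ENNReal.toReal_ofNat, Real.rpow_ofNat] using h

end Embedding

theorem approxNum_nonneg {X Y : Type*} [NormedAddCommGroup X] [NormedSpace ℂ X]
    [NormedAddCommGroup Y] [NormedSpace ℂ Y] (T : X →L[ℂ] Y) (n : ℕ) : 0 ≤ approxNum T n := by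
  refine Real.sInf_nonneg ?_
  rintro _ ⟨A, _, rfl⟩
  exact norm_nonneg _

theorem approxNum_le_norm_sub {X Y : Type*} [NormedAddCommGroup X] [NormedSpace ℂ X]
    [NormedAddCommGroup Y] [NormedSpace ℂ Y] (T : X →L[ℂ] Y) {n : ℕ} {A : X →L[ℂ] Y}
    (hA : Module.rank ℂ (LinearMap.range (A : X →ₗ[ℂ] Y)) < n) : approxNum T n ≤ ‖T - A‖ := by
  refine csInf_le ⟨0, ?_⟩ ⟨A, hA, rfl⟩
  rintro _ ⟨B, _, rfl⟩
  exact norm_nonneg _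

theorem le_approxNum {X Y : Type*} [NormedAddCommGroup X] [NormedSpace ℂ X]
    [NormedAddCommGroup Y] [NormedSpace ℂ Y] (T : X →L[ℂ] Y) {n : ℕ} (hn : 0 < n) {b : ℝ}
    (hb : ∀ A : X →L[ℂ] Y, Module.rank ℂ (LinearMap.range (A : X →ₗ[ℂ] Y)) < n → b ≤ ‖T - A‖) :
    b ≤ approxNum T n := by
  refine le_csInf ⟨‖T - 0‖, 0, ?_, rfl⟩ ?_
  · have h0 : LinearMap.range ((0 : X →L[ℂ] Y) : X →ₗ[ℂ] Y) = ⊥ := by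
      rw [ContinuousLinearMap.toLinearMap_zero, LinearMap.range_zero]
    rw [h0, rank_bot]
    exact_mod_cast hn
  · rintro _ ⟨A, hA, rfl⟩
    exact hb A hA

theorem inv_wMix_sq {d : ℕ} {s r : ℝ} (hr : 0 < r) (k : ZLat d) :
    (wMix d s r k)⁻¹ ^ 2 = mixNorm r k ^ (-(2 * s)) := by
  have h := (mixNorm_pos hr k).le
  rw [wMix_eq_mixNorm_rpow hr, ← Real.rpow_neg h, ← Real.rpow_natCast, ← Real.rpow_mul h]
  congr 1
  push_cast
  ring

theorem crossTail_eq_tsum_inv_wMix_sq {d : ℕ} {s r : ℝ} (hr : 0 < r) (x : ℝ) :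
    crossTail r s d x = ∑' k, (if k ∈ hypCross r d x then 0 else (wMix d s r k)⁻¹ ^ 2) := by
  simp only [crossTail, mem_hypCross hr, inv_wMix_sq hr]

/-- Theorem 4 of Cobos–Kühn–Sickel. For `d ∈ ℕ`, `s > 1/2` and
`0 < r < ∞`,
`lim_{n→∞} n^{s-1/2} a_n(I_d : H^{s,r}_mix(𝕋^d) → L_∞(𝕋^d)) / (ln n)^{(d-1)s}
  = (1/√(2s-1)) (2^d/(d-1)!)^s`. -/
theorem statement10 (d : ℕ) (hd : 0 < d) (s r : ℝ) (hs : 1 / 2 < s) (hr : 0 < r)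
    (T : ellTwo d →L[ℂ] Lp ℂ ⊤ (torusMeasure d))
    (hT : ∀ (c : ellTwo d) (k : ZLat d), fourierCoef (⇑(T c)) k = c k / (wMix d s r k : ℂ)) :
    Tendsto
      (fun n : ℕ =>
        (n : ℝ) ^ (s - 1 / 2) * approxNum T n / Real.log n ^ (((d : ℝ) - 1) * s))
      atTop
      (nhds ((1 / Real.sqrt (2 * s - 1)) *
        ((2 : ℝ) ^ d / (Nat.factorial (d - 1) : ℝ)) ^ s)) := by
  obtain ⟨D, rfl⟩ := Nat.exists_eq_succ_of_ne_zero hd.ne'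
  simp only [Nat.succ_eq_add_one, Nat.add_sub_cancel, Nat.cast_add, Nat.cast_one,
    add_sub_cancel_right] at *
  have hs0 : 0 ≤ s := by linarith
  have hw : ∀ k : ZLat (D + 1), 0 < wMix (D + 1) s r k := fun k => by
    rw [wMix_eq_mixNorm_rpow hr]
    exact Real.rpow_pos_of_pos (mixNorm_pos hr k) s
  refine tendsto_of_crossTail_bounds hr hs D ?_ (approxNum_nonneg T) ?_ ?_
  · simpa only [inv_wMix_sq hr] using summable_inv_sq_of_embedding hT hw
  · intro n x hn
    obtain ⟨A, hA, hTA⟩ := exists_rank_le_norm_sub_le hT hw (hypCross r (D + 1) x)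
    rw [← crossTail_eq_tsum_inv_wMix_sq hr] at hTA
    have h := (approxNum_le_norm_sub T (hA.trans_lt (Nat.cast_lt.2 hn))).trans hTA
    have h0 : 0 ≤ crossTail r s (D + 1) x := tsum_nonneg fun k => by
      split_ifs
      exacts [le_rfl, Real.rpow_nonneg (mixNorm_pos hr k).le _]
    exact (pow_le_pow_left₀ (approxNum_nonneg T n) h 2).trans_eq (Real.sq_sqrt h0)
  · intro n x hn0 hn
    rw [← Real.sqrt_le_left (approxNum_nonneg T n)]
    refine le_approxNum T hn0 fun A hA => ?_
    rw [Real.sqrt_le_left (norm_nonneg _), crossTail_eq_tsum_inv_wMix_sq hr]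
    obtain ⟨ρ, hρ, hH, hH'⟩ : ∃ ρ : ℝ, 0 ≤ ρ ∧
        (∀ k ∈ hypCross r (D + 1) x, ρ ≤ (wMix (D + 1) s r k)⁻¹ ^ 2) ∧
        ∀ k ∉ hypCross r (D + 1) x, (wMix (D + 1) s r k)⁻¹ ^ 2 ≤ ρ := by
      simp only [inv_wMix_sq hr, mem_hypCross hr]
      refine ⟨(max x 1) ^ (-(2 * s)), Real.rpow_nonneg (by positivity) _, fun k hk => ?_,
        fun k hk => ?_⟩
      · exact Real.rpow_le_rpow_of_nonpos (mixNorm_pos hr k) (hk.trans (le_max_left _ _))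
          (by linarith)
      · exact Real.rpow_le_rpow_of_nonpos (by positivity)
          (max_le (not_le.1 hk).le (one_le_mixNorm hr k)) (by linarith)
    exact tsum_tail_le_norm_sub_sq hT hw hA hn hρ hH hH'
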